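/- arXiv:1202.3463 — 2 statements merged into one kernel-verified Lean document; each statement's English description precedes it below -/
import Mathlib

section
/- For all integers m ≥ 1 and k ≥ 1, the natural surjection 𝒯̃_{2k−1} → 𝒯^∞_{2k−1} induced by the identity on generators of 𝒯_{2k−1} is well defined (every framing relator Δ_{2k−1}(t) is a sum of boundary-twist relators), and its kernel is isomorphic to ℤ₂ ⊗ L'_{k+1}; that is, there is a short exact sequence 0 → ℤ₂ ⊗ L'_{k+1} → 𝒯̃_{2k−1} → 𝒯^∞_{2k−1} → 0. -/
open scoped TensorProduct

/-- Rooted binary trees (formal non-associative bracket monomials) with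
leaves labeled in `Fin m`.  The degree is the number of leaves, the order is
the degree minus one. -/
inductive RTree (m : ℕ) : Type
  | leaf : Fin m → RTree m
  | node : RTree m → RTree m → RTree m

namespace RTree

/-- The degree of a rooted tree = its number of leaves. -/
def deg {m : ℕ} : RTree m → ℕ
  | leaf _ => 1
  | node a b => deg a + deg b

end RTree

/-- One-hole contexts for rooted trees. -/
inductive Ctx (m : ℕ) : Type
  | hole : Ctx m
  | nodeL : Ctx m → RTree m → Ctx m
  | nodeR : RTree m → Ctx m → Ctx m

/-- Fill the hole of a context with a rooted tree. -/
def Ctx.fill {m : ℕ} : Ctx m → RTree m → RTree m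
  | .hole, t => t
  | .nodeL c r, t => RTree.node (c.fill t) r
  | .nodeR l c, t => RTree.node l (c.fill t)

/-- Relators presenting the degree `n` part `L'_n` of the free quasi-Lie ring:
generators of the wrong degree are killed, and antisymmetry and Jacobi
relators are imposed at every position (one-hole context). -/
def quasiLieRels (m n : ℕ) : Set (FreeAbelianGroup (RTree m)) :=
  {x | ∃ J : RTree m, J.deg ≠ n ∧ x = FreeAbelianGroup.of J} ∪
  {x | ∃ (c : Ctx m) (A B : RTree m),
      x = FreeAbelianGroup.of (c.fill (RTree.node A B)) +
          FreeAbelianGroup.of (c.fill (RTree.node B A))} ∪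
  {x | ∃ (c : Ctx m) (A B C : RTree m),
      x = FreeAbelianGroup.of (c.fill (RTree.node A (RTree.node B C))) -
          FreeAbelianGroup.of (c.fill (RTree.node (RTree.node A B) C)) -
          FreeAbelianGroup.of (c.fill (RTree.node B (RTree.node A C)))}

/-- `L'_n`, the degree `n` part of Levine's free quasi-Lie ring on `X_1,…,X_m`. -/
abbrev Lp (m n : ℕ) :=
  FreeAbelianGroup (RTree m) ⧸ AddSubgroup.closure (quasiLieRels m n)

/-- The canonical projection onto `L'_n`. -/
abbrev LpMk (m n : ℕ) : FreeAbelianGroup (RTree m) →+ Lp m n :=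
  QuotientAddGroup.mk' _

/-- Relators for the free Lie ring: additionally kill all squares `[J,J]`
(at every position). -/
def lieRels (m n : ℕ) : Set (FreeAbelianGroup (RTree m)) :=
  quasiLieRels m n ∪
  {x | ∃ (c : Ctx m) (J : RTree m), x = FreeAbelianGroup.of (c.fill (RTree.node J J))}

/-- `L_n`, the degree `n` part of the free Lie ring on `X_1,…,X_m` over `ℤ`. -/
abbrev LL (m n : ℕ) :=
  FreeAbelianGroup (RTree m) ⧸ AddSubgroup.closure (lieRels m n)

/-- The canonical projection onto `L_n`. -/
abbrev LLMk (m n : ℕ) : FreeAbelianGroup (RTree m) →+ LL m n :=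
  QuotientAddGroup.mk' _

/-- The canonical projection `L'_n → L_n`. -/
def LpToLL (m n : ℕ) : Lp m n →+ LL m n :=
  QuotientAddGroup.map _ _ (AddMonoidHom.id _)
    (by
      rw [AddSubgroup.comap_id]
      exact AddSubgroup.closure_mono Set.subset_union_left)

/-- Free-level bracketing `t ↦ [X i, t]` with a degree one generator. -/
def brLeafFree (m : ℕ) (i : Fin m) :
    FreeAbelianGroup (RTree m) →+ FreeAbelianGroup (RTree m) :=
  FreeAbelianGroup.lift fun t => FreeAbelianGroup.of (RTree.node (RTree.leaf i) t)

theorem brLeafFree_mem_quasi {m n : ℕ} (i : Fin m) {x : FreeAbelianGroup (RTree m)}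
    (hx : x ∈ quasiLieRels m n) :
    brLeafFree m i x ∈ AddSubgroup.closure (quasiLieRels m (n + 1)) := by
  apply AddSubgroup.subset_closure
  rcases hx with (⟨J, hJ, rfl⟩ | ⟨c, A, B, rfl⟩) | ⟨c, A, B, C, rfl⟩
  · refine Or.inl (Or.inl ⟨RTree.node (RTree.leaf i) J, ?_, ?_⟩)
    · simp only [RTree.deg]; omega
    · simp [brLeafFree]
  · refine Or.inl (Or.inr ⟨Ctx.nodeR (RTree.leaf i) c, A, B, ?_⟩)
    simp [brLeafFree, Ctx.fill]
  · refine Or.inr ⟨Ctx.nodeR (RTree.leaf i) c, A, B, C, ?_⟩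
    simp [brLeafFree, Ctx.fill]

theorem brLeafFree_closure_quasi {m n : ℕ} (i : Fin m) :
    AddSubgroup.closure (quasiLieRels m n) ≤
      (AddSubgroup.closure (quasiLieRels m (n + 1))).comap (brLeafFree m i) :=
  (AddSubgroup.closure_le _).2 fun _x hx =>
    AddSubgroup.mem_comap.2 (brLeafFree_mem_quasi i hx)

/-- Bracketing `[X_i, ·] : L'_n → L'_{n+1}` with a degree one generator. -/
def brLeaf (m n : ℕ) (i : Fin m) : Lp m n →+ Lp m (n + 1) :=
  QuotientAddGroup.map _ _ (brLeafFree m i) (brLeafFree_closure_quasi i)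

theorem brLeafFree_mem_lie {m n : ℕ} (i : Fin m) {x : FreeAbelianGroup (RTree m)}
    (hx : x ∈ lieRels m n) :
    brLeafFree m i x ∈ AddSubgroup.closure (lieRels m (n + 1)) := by
  apply AddSubgroup.subset_closure
  rcases hx with ((⟨J, hJ, rfl⟩ | ⟨c, A, B, rfl⟩) | ⟨c, A, B, C, rfl⟩) | ⟨c, J, rfl⟩
  · refine Or.inl (Or.inl (Or.inl ⟨RTree.node (RTree.leaf i) J, ?_, ?_⟩))
    · simp only [RTree.deg]; omega
    · simp [brLeafFree]
  · exact Or.inl (Or.inl (Or.inr ⟨Ctx.nodeR (RTree.leaf i) c, A, B, by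
      simp [brLeafFree, Ctx.fill]⟩))
  · exact Or.inl (Or.inr ⟨Ctx.nodeR (RTree.leaf i) c, A, B, C, by
      simp [brLeafFree, Ctx.fill]⟩)
  · exact Or.inr ⟨Ctx.nodeR (RTree.leaf i) c, J, by simp [brLeafFree, Ctx.fill]⟩

theorem brLeafFree_closure_lie {m n : ℕ} (i : Fin m) :
    AddSubgroup.closure (lieRels m n) ≤
      (AddSubgroup.closure (lieRels m (n + 1))).comap (brLeafFree m i) :=
  (AddSubgroup.closure_le _).2 fun _x hx =>
    AddSubgroup.mem_comap.2 (brLeafFree_mem_lie i hx)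

/-- Bracketing `[X_i, ·] : L_n → L_{n+1}` with a degree one generator. -/
def brLeafL (m n : ℕ) (i : Fin m) : LL m n →+ LL m (n + 1) :=
  QuotientAddGroup.map _ _ (brLeafFree m i) (brLeafFree_closure_lie i)

/-- The bracket map `L'_1 ⊗ L'_a → L'_{a+1}`, `X_i ⊗ Y ↦ [X_i, Y]`,
where `L'_1 = L_1 ≅ ℤ^m` is realized as `FreeAbelianGroup (Fin m)` with basis `X_i`.
The kernel of `bracketLp m (n+1)` is the group `D'_n`. -/
noncomputable def bracketLp (m a : ℕ) :
    (FreeAbelianGroup (Fin m)) ⊗[ℤ] (Lp m a) →ₗ[ℤ] Lp m (a + 1) :=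
  TensorProduct.lift
    ((FreeAbelianGroup.lift fun i => (brLeaf m a i).toIntLinearMap).toIntLinearMap)

/-- The bracket map `L_1 ⊗ L_a → L_{a+1}`.  The kernel of `bracketLL m (n+1)` is `D_n`. -/
noncomputable def bracketLL (m a : ℕ) :
    (FreeAbelianGroup (Fin m)) ⊗[ℤ] (LL m a) →ₗ[ℤ] LL m (a + 1) :=
  TensorProduct.lift
    ((FreeAbelianGroup.lift fun i => (brLeafL m a i).toIntLinearMap).toIntLinearMap)

/-- `id ⊗ proj : L_1 ⊗ L'_n → L_1 ⊗ L_n`. -/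
noncomputable def projT (m n : ℕ) :
    (FreeAbelianGroup (Fin m)) ⊗[ℤ] (Lp m n) →ₗ[ℤ]
      (FreeAbelianGroup (Fin m)) ⊗[ℤ] (LL m n) :=
  LinearMap.lTensor _ (LpToLL m n).toIntLinearMap

/-- Given a rooted tree `t` and a rooted tree `rest` (representing the rest of the
unrooted tree `⟨t, rest⟩` hanging off the root edge of `t`), list, for each leaf `v`
of `t`, the label of `v` together with the rooted tree obtained from the unrooted
tree `⟨t, rest⟩` by making `v` the root. -/
def rerootList {m : ℕ} : RTree m → RTree m → List (Fin m × RTree m)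
  | RTree.leaf i, rest => [(i, rest)]
  | RTree.node a b, rest =>
      rerootList a (RTree.node b rest) ++ rerootList b (RTree.node rest a)

/-- All univalent vertices of the unrooted tree `⟨p.1, p.2⟩`, together with the
corresponding rerooted trees. -/
def pairReroots {m : ℕ} (p : RTree m × RTree m) : List (Fin m × RTree m) :=
  rerootList p.1 p.2 ++ rerootList p.2 p.1

/-- Relators presenting the order `n` tree group `𝒯_n`.  An unrooted unitrivalent
labeled vertex-oriented tree is presented as the inner product `⟨I,J⟩` of a pair of
rooted trees (cutting an edge); generators of the wrong order are killed, and we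
impose: symmetry `⟨I,J⟩ = ⟨J,I⟩`, edge-sliding `⟨(A,B),C⟩ = ⟨A,(B,C)⟩` (both of
which express that the pair presents the same unrooted tree), antisymmetry (AS),
and Jacobi (IHX) relations. -/
def treeRels (m n : ℕ) : Set (FreeAbelianGroup (RTree m × RTree m)) :=
  {x | ∃ p : RTree m × RTree m, p.1.deg + p.2.deg ≠ n + 2 ∧ x = FreeAbelianGroup.of p} ∪
  {x | ∃ I J : RTree m, x = FreeAbelianGroup.of (I, J) - FreeAbelianGroup.of (J, I)} ∪
  {x | ∃ A B C : RTree m,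
      x = FreeAbelianGroup.of (RTree.node A B, C) - FreeAbelianGroup.of (A, RTree.node B C)} ∪
  {x | ∃ A B C : RTree m,
      x = FreeAbelianGroup.of (RTree.node A B, C) + FreeAbelianGroup.of (RTree.node B A, C)} ∪
  {x | ∃ A B C D : RTree m,
      x = FreeAbelianGroup.of (RTree.node A (RTree.node B C), D)
        - FreeAbelianGroup.of (RTree.node (RTree.node A B) C, D)
        - FreeAbelianGroup.of (RTree.node B (RTree.node A C), D)}

/-- `𝒯_n`, the order `n` tree group. -/
abbrev Tgrp (m n : ℕ) :=
  FreeAbelianGroup (RTree m × RTree m) ⧸ AddSubgroup.closure (treeRels m n)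

/-- The canonical projection onto `𝒯_n`; the generator `⟨I,J⟩` is `TMk m n (.of (I,J))`. -/
abbrev TMk (m n : ℕ) : FreeAbelianGroup (RTree m × RTree m) →+ Tgrp m n :=
  QuotientAddGroup.mk' _

/-- The boundary-twist relators `⟨(i,J),J⟩` (for `J` of order `k-1`, i.e. degree `k`). -/
def btRels (m k : ℕ) : Set (FreeAbelianGroup (RTree m × RTree m)) :=
  {x | ∃ (i : Fin m) (J : RTree m), J.deg = k ∧
      x = FreeAbelianGroup.of (RTree.node (RTree.leaf i) J, J)}

/-- `𝒯^∞_{2k-1}`, the quotient of `𝒯_{2k-1}` by the boundary-twist relations. -/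
abbrev Tinfodd (m k : ℕ) :=
  FreeAbelianGroup (RTree m × RTree m) ⧸
    AddSubgroup.closure (treeRels m (2 * k - 1) ∪ btRels m k)

abbrev TinfoddMk (m k : ℕ) : FreeAbelianGroup (RTree m × RTree m) →+ Tinfodd m k :=
  QuotientAddGroup.mk' _

/-- Relators presenting `𝒯^∞_{2k}`: generators are order `2k` unrooted trees
(`Sum.inl` of a pair of rooted trees, as in `treeRels`) together with `∞`-trees
`J^∞` (`Sum.inr J`) for rooted trees `J` of order `k` (degree `k+1`).  Relations:
the relations of `𝒯_{2k}` among the non-`∞` trees, wrong-degree `∞`-generators are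
killed, the symmetry relations `(-J)^∞ = J^∞`, the twisted IHX relations
`I^∞ = H^∞ + X^∞ - ⟨H,X⟩`, and the interior-twist relations `2 J^∞ = ⟨J,J⟩`. -/
def tinfRels (m k : ℕ) : Set (FreeAbelianGroup ((RTree m × RTree m) ⊕ RTree m)) :=
  (⇑(FreeAbelianGroup.map (Sum.inl : RTree m × RTree m → (RTree m × RTree m) ⊕ RTree m)) ''
      treeRels m (2 * k)) ∪
  {x | ∃ J : RTree m, J.deg ≠ k + 1 ∧ x = FreeAbelianGroup.of (Sum.inr J)} ∪
  {x | ∃ (c : Ctx m) (A B : RTree m),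
      x = FreeAbelianGroup.of (Sum.inr (c.fill (RTree.node A B)))
        - FreeAbelianGroup.of (Sum.inr (c.fill (RTree.node B A)))} ∪
  {x | ∃ (c : Ctx m) (A B C : RTree m),
      x = FreeAbelianGroup.of (Sum.inr (c.fill (RTree.node A (RTree.node B C))))
        - FreeAbelianGroup.of (Sum.inr (c.fill (RTree.node (RTree.node A B) C)))
        - FreeAbelianGroup.of (Sum.inr (c.fill (RTree.node B (RTree.node A C))))
        + FreeAbelianGroup.of (Sum.inl (c.fill (RTree.node (RTree.node A B) C),
            c.fill (RTree.node B (RTree.node A C))))} ∪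
  {x | ∃ J : RTree m,
      x = FreeAbelianGroup.of (Sum.inr J) + FreeAbelianGroup.of (Sum.inr J)
        - FreeAbelianGroup.of (Sum.inl (J, J))}

/-- `𝒯^∞_{2k}`, the twisted tree group in even order `2k`. -/
abbrev Tinf (m k : ℕ) :=
  FreeAbelianGroup ((RTree m × RTree m) ⊕ RTree m) ⧸ AddSubgroup.closure (tinfRels m k)

abbrev TinfMk (m k : ℕ) :
    FreeAbelianGroup ((RTree m × RTree m) ⊕ RTree m) →+ Tinf m k :=
  QuotientAddGroup.mk' _

/-- The degree-guarded free-level bracket: for `s, t` rooted trees,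
`brFree m a b (of s) (of t) = of [s,t]` if `s` has degree `a` and `t` degree `b`,
and `0` otherwise.  It induces the bracket `L'_a × L'_b → L'_{a+b}`. -/
def brFree (m a b : ℕ) :
    FreeAbelianGroup (RTree m) →+
      FreeAbelianGroup (RTree m) →+ FreeAbelianGroup (RTree m) :=
  FreeAbelianGroup.lift fun s =>
    FreeAbelianGroup.lift fun t =>
      if s.deg = a ∧ t.deg = b then FreeAbelianGroup.of (RTree.node s t) else 0

/-- Quasi-Lie rings of characteristic two. -/
class IsQuasiLieTwo (Q : Type*) [NonUnitalNonAssocRing Q] : Prop where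
  add_self (x : Q) : x + x = 0
  mul_comm (x y : Q) : x * y = y * x
  jacobi (x y z : Q) : x * (y * z) = x * y * z + y * (x * z)

namespace IsQuasiLieTwo

variable {Q : Type*} [NonUnitalNonAssocRing Q] [IsQuasiLieTwo Q]

theorem mul_square (w y : Q) : w * (y * y) = 0 := by
  rw [jacobi, mul_comm w y, mul_comm (y * w) y, add_self]

theorem add_mul_add_self (x y : Q) : (x + y) * (x + y) = x * x + y * y := by
  have h : x * y + y * x = 0 := by rw [mul_comm y x, add_self]
  calc (x + y) * (x + y) = x * x + y * y + (x * y + y * x) := by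
        simp only [add_mul, mul_add]; abel
    _ = _ := by rw [h, add_zero]

theorem jacobi_cyclic (x y z : Q) : x * (y * z) + y * (z * x) + z * (x * y) = 0 := by
  rw [jacobi x y z, mul_comm z x, mul_comm z (x * y), add_assoc (x * y * z), add_self, add_zero,
    add_self]

end IsQuasiLieTwo

/-- The free nonassociative ring on `α`. -/
abbrev FreeNonAssoc (α : Type) := FreeAbelianGroup (FreeMagma α)

/-- The relators of the free quasi-Lie ring of characteristic two. -/
def qlRels (α : Type) : Set (FreeNonAssoc α) :=
  {x | ∃ a : FreeMagma α, x = .of a + .of a} ∪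
  {x | ∃ a b : FreeMagma α, x = .of (a * b) + .of (b * a)} ∪
  {x | ∃ a b c : FreeMagma α, x = .of (a * (b * c)) + .of (a * b * c) + .of (b * (a * c))}

/-- The free quasi-Lie ring of characteristic two on `α`. -/
def QL (α : Type) : Type := (TwoSidedIdeal.span (qlRels α)).ringCon.Quotient

namespace QL

variable {α : Type}

instance : NonUnitalNonAssocRing (QL α) :=
  inferInstanceAs (NonUnitalNonAssocRing (TwoSidedIdeal.span (qlRels α)).ringCon.Quotient)

/-- The canonical projection from the free nonassociative ring. -/
def mk : FreeNonAssoc α →ₙ+* QL α where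
  toFun x := ((x : (TwoSidedIdeal.span (qlRels α)).ringCon.Quotient))
  map_mul' _ _ := rfl
  map_zero' := rfl
  map_add' _ _ := rfl

/-- The class of a bracket monomial. -/
def tree : FreeMagma α →ₙ* QL α where
  toFun t := mk (.of t)
  map_mul' a b := by rw [← map_mul, FreeAbelianGroup.of_mul_of]

theorem mk_of (t : FreeMagma α) : mk (.of t) = tree t := rfl

theorem mk_surjective : Function.Surjective (mk : FreeNonAssoc α → QL α) := by
  rintro ⟨x⟩
  exact ⟨x, rfl⟩

theorem mk_eq_iff {x y : FreeNonAssoc α} :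
    mk x = mk y ↔ x - y ∈ TwoSidedIdeal.span (qlRels α) := by
  rw [← TwoSidedIdeal.rel_iff]
  exact RingCon.eq _

theorem mk_eq_zero {x : FreeNonAssoc α} (hx : x ∈ qlRels α) : mk x = 0 := by
  rw [← map_zero mk, mk_eq_iff, sub_zero]
  exact TwoSidedIdeal.subset_span hx

/-- Additive maps out of `QL α` from additive maps killing an ideal that contains the relators. -/
def liftAdd {N : Type*} [AddCommGroup N] (g : FreeNonAssoc α →+ N)
    (I : TwoSidedIdeal (FreeNonAssoc α)) (hI : qlRels α ⊆ I) (hg : ∀ x ∈ I, g x = 0) :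
    QL α →+ N where
  toFun := Quotient.lift g fun x y h => by
    have h' : x - y ∈ TwoSidedIdeal.span (qlRels α) := (TwoSidedIdeal.rel_iff _ _ _).1 h
    have := hg _ (TwoSidedIdeal.span_le.2 hI h')
    rwa [map_sub, sub_eq_zero] at this
  map_zero' := g.map_zero
  map_add' := by
    rintro ⟨x⟩ ⟨y⟩
    exact g.map_add x y

theorem liftAdd_tree {N : Type*} [AddCommGroup N] (g : FreeNonAssoc α →+ N)
    (I : TwoSidedIdeal (FreeNonAssoc α)) (hI : qlRels α ⊆ I) (hg : ∀ x ∈ I, g x = 0)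
    (t : FreeMagma α) : liftAdd g I hI hg (tree t) = g (.of t) := rfl

/-- Additive maps out of `QL α` from additive maps killing the relators, and killing the products
with elements that they kill and that vanish in `QL α`. -/
def liftAddOfMul {N : Type*} [AddCommGroup N] (g : FreeNonAssoc α →+ N)
    (hrel : ∀ x ∈ qlRels α, g x = 0) (hl : ∀ x y, mk x = 0 → g x = 0 → g (x * y) = 0)
    (hr : ∀ x y, mk y = 0 → g y = 0 → g (x * y) = 0) : QL α →+ N :=
  liftAdd g
    (.mk' {x | mk x = 0 ∧ g x = 0} (by simp)
      (by rintro x y ⟨h, h'⟩ ⟨i, i'⟩; exact ⟨by rw [map_add, h, i, add_zero],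
        by rw [map_add, h', i', add_zero]⟩)
      (by rintro x ⟨h, h'⟩; exact ⟨by rw [map_neg, h, neg_zero], by rw [map_neg, h', neg_zero]⟩)
      (by rintro x y ⟨h, h'⟩; exact ⟨by rw [map_mul, h, mul_zero], hr _ _ h h'⟩)
      (by rintro x y ⟨h, h'⟩; exact ⟨by rw [map_mul, h, zero_mul], hl _ _ h h'⟩))
    (fun x hx => (TwoSidedIdeal.mem_mk' ..).2 ⟨mk_eq_zero hx, hrel x hx⟩)
    fun _ hx => ((TwoSidedIdeal.mem_mk' ..).1 hx).2

theorem liftAddOfMul_tree {N : Type*} [AddCommGroup N] (g : FreeNonAssoc α →+ N)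
    (hrel : ∀ x ∈ qlRels α, g x = 0) (hl : ∀ x y, mk x = 0 → g x = 0 → g (x * y) = 0)
    (hr : ∀ x y, mk y = 0 → g y = 0 → g (x * y) = 0) (t : FreeMagma α) :
    liftAddOfMul g hrel hl hr (tree t) = g (.of t) := rfl

theorem add_self (x : QL α) : x + x = 0 := by
  obtain ⟨x, rfl⟩ := mk_surjective x
  induction x using FreeAbelianGroup.induction_on with
  | zero => simp
  | of t => exact mk_eq_zero (x := .of t + .of t) (Or.inl (Or.inl ⟨t, rfl⟩))
  | neg t h => rw [map_neg, ← neg_add, h, neg_zero]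
  | add x y hx hy => rw [map_add, add_add_add_comm, hx, hy, add_zero]

theorem neg_eq (x : QL α) : -x = x := neg_eq_of_add_eq_zero_left (add_self x)

@[elab_as_elim]
theorem induction {P : QL α → Prop} (zero : P 0) (tree : ∀ t, P (tree t))
    (add : ∀ x y, P x → P y → P (x + y)) (x : QL α) : P x := by
  obtain ⟨x, rfl⟩ := mk_surjective x
  induction x using FreeAbelianGroup.induction_on with
  | zero => rwa [map_zero]
  | of t => exact tree t
  | neg t h => rwa [map_neg, neg_eq]
  | add x y hx hy => rw [map_add]; exact add _ _ hx hy

theorem add_eq_zero {x y : QL α} : x + y = 0 ↔ x = y := by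
  rw [add_eq_zero_iff_eq_neg, neg_eq]

instance : IsQuasiLieTwo (QL α) where
  add_self := add_self
  mul_comm x y := by
    induction x using induction with
    | zero => simp
    | add x x' h h' => rw [add_mul, mul_add, h, h']
    | tree s =>
      induction y using induction with
      | zero => simp
      | add x x' h h' => rw [add_mul, mul_add, h, h']
      | tree t =>
        rw [← add_eq_zero, ← map_mul, ← map_mul]
        exact mk_eq_zero (x := .of (s * t) + .of (t * s)) (Or.inl (Or.inr ⟨s, t, rfl⟩))
  jacobi x y z := by
    rw [← add_eq_zero, ← add_assoc]
    induction x using induction with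
    | zero => simp
    | add x x' h h' =>
      simp only [add_mul, mul_add]
      rw [← add_zero (0 : QL α)]
      nth_rw 1 [← h, ← h']
      abel
    | tree s =>
      induction y using induction with
      | zero => simp
      | add x x' h h' =>
        simp only [add_mul, mul_add]
        rw [← add_zero (0 : QL α)]
        nth_rw 1 [← h, ← h']
        abel
      | tree t =>
        induction z using induction with
        | zero => simp
        | add x x' h h' =>
          simp only [mul_add]
          rw [← add_zero (0 : QL α)]
          nth_rw 1 [← h, ← h']
          abel
        | tree u =>
          simp only [← map_mul]
          exact mk_eq_zero (x := .of (s * (t * u)) + .of (s * t * u) + .of (t * (s * u)))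
            (Or.inr ⟨s, t, u, rfl⟩)

variable {Q : Type*} [NonUnitalNonAssocRing Q]

/-- The ring homomorphism from the free nonassociative ring extending a map on generators. -/
def freeLift (f : α → Q) : FreeNonAssoc α →ₙ+* Q where
  toFun := FreeAbelianGroup.lift (FreeMagma.lift f)
  map_zero' := map_zero _
  map_add' := map_add _
  map_mul' x y := by
    induction x using FreeAbelianGroup.induction_on with
    | zero => simp
    | neg s h => rw [neg_mul, map_neg, h, map_neg, neg_mul]
    | add x x' h h' => rw [add_mul, map_add, h, h', map_add, add_mul]
    | of s =>
      induction y using FreeAbelianGroup.induction_on with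
      | zero => simp
      | neg s h => rw [mul_neg, map_neg, h, map_neg, mul_neg]
      | add x x' h h' => rw [mul_add, map_add, h, h', map_add, mul_add]
      | of t => simp [FreeAbelianGroup.of_mul_of]

theorem freeLift_of (f : α → Q) (t : FreeMagma α) : freeLift f (.of t) = FreeMagma.lift f t :=
  FreeAbelianGroup.lift_apply_of _ _

variable [IsQuasiLieTwo Q]

theorem qlRels_subset_ker (f : α → Q) :
    qlRels α ⊆ (TwoSidedIdeal.ker (freeLift f) : TwoSidedIdeal (FreeNonAssoc α)) := by
  rintro x ((⟨a, rfl⟩ | ⟨a, b, rfl⟩) | ⟨a, b, c, rfl⟩) <;>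
    simp only [SetLike.mem_coe, TwoSidedIdeal.mem_ker, map_add, freeLift_of, map_mul]
  · exact IsQuasiLieTwo.add_self _
  · rw [IsQuasiLieTwo.mul_comm, IsQuasiLieTwo.add_self]
  · rw [IsQuasiLieTwo.jacobi, add_assoc, IsQuasiLieTwo.add_self]

/-- The universal property of `QL α`. -/
def lift (f : α → Q) : QL α →ₙ+* Q where
  __ := liftAdd (AddMonoidHomClass.toAddMonoidHom (freeLift f)) (TwoSidedIdeal.ker (freeLift f))
    (qlRels_subset_ker f) fun _ hx => (TwoSidedIdeal.mem_ker (freeLift f)).1 hx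
  map_mul' := by
    rintro ⟨x⟩ ⟨y⟩
    exact (freeLift f).map_mul x y

theorem lift_tree (f : α → Q) (t : FreeMagma α) : lift f (tree t) = FreeMagma.lift f t :=
  freeLift_of f t

end QL

namespace QL

variable {α : Type}

instance : Module (ZMod 2) (QL α) :=
  AddCommGroup.zmodModule fun x => by rw [two_nsmul, add_self]

instance : IsScalarTower (ZMod 2) (QL α) (QL α) :=
  ⟨fun a x y => ZMod.map_smul (AddMonoidHom.mulRight y) a x⟩

instance : SMulCommClass (ZMod 2) (QL α) (QL α) :=
  ⟨fun a x y => (ZMod.map_smul (AddMonoidHom.mulLeft x) a y).symm⟩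

/-- The additive map on the free nonassociative ring underlying the shift derivation. -/
def shiftFree : FreeNonAssoc (α × ℕ) →+ QL (α × ℕ) :=
  FreeAbelianGroup.lift fun t => FreeMagma.recOnMul (C := fun _ => QL (α × ℕ)) t
    (fun p => tree (.of (p.1, p.2 + 1))) fun s t ds dt => ds * tree t + tree s * dt

theorem shiftFree_mul (x y : FreeNonAssoc (α × ℕ)) :
    shiftFree (x * y) = shiftFree x * mk y + mk x * shiftFree y := by
  induction x using FreeAbelianGroup.induction_on with
  | zero => simp
  | neg s h => rw [neg_mul, map_neg, h, map_neg, map_neg, neg_mul, neg_mul, neg_add]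
  | add x x' h h' => simp only [add_mul, map_add, h, h']; abel
  | of s =>
    induction y using FreeAbelianGroup.induction_on with
    | zero => simp
    | neg s h => rw [mul_neg, map_neg, h, map_neg, map_neg, mul_neg, mul_neg, neg_add]
    | add x x' h h' => simp only [mul_add, map_add, h, h']; abel
    | of t =>
      rw [FreeAbelianGroup.of_mul_of]
      simp only [shiftFree, FreeAbelianGroup.lift_apply_of]
      rfl

theorem shiftFree_qlRels {x : FreeNonAssoc (α × ℕ)} (hx : x ∈ qlRels (α × ℕ)) :
    shiftFree x = 0 := by
  obtain (⟨a, rfl⟩ | ⟨a, b, rfl⟩) | ⟨a, b, c, rfl⟩ := hx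
  · rw [map_add, add_self]
  · rw [map_add, ← FreeAbelianGroup.of_mul_of, ← FreeAbelianGroup.of_mul_of, shiftFree_mul,
      shiftFree_mul, IsQuasiLieTwo.mul_comm _ (mk (.of b)), IsQuasiLieTwo.mul_comm _ (mk (.of a))]
    abel_nf
    simp only [two_zsmul, add_self, add_zero]
  · simp only [map_add, ← FreeAbelianGroup.of_mul_of, shiftFree_mul, map_mul, add_mul, mul_add,
      IsQuasiLieTwo.jacobi (shiftFree (.of a)), IsQuasiLieTwo.jacobi (mk (.of a))]
    abel_nf
    simp only [two_zsmul, add_self, add_zero]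

/-- The derivation of `QL (α × ℕ)` raising the second coordinate of each generator by one. -/
def shift : QL (α × ℕ) →+ QL (α × ℕ) :=
  liftAddOfMul shiftFree (fun _ => shiftFree_qlRels)
    (fun x y h h' => by rw [shiftFree_mul, h, h', zero_mul, zero_mul, add_zero])
    (fun x y h h' => by rw [shiftFree_mul, h, h', mul_zero, mul_zero, add_zero])

theorem shift_of (p : α × ℕ) : shift (tree (.of p)) = tree (.of (p.1, p.2 + 1)) := by
  simp only [shift, liftAddOfMul_tree, shiftFree, FreeAbelianGroup.lift_apply_of]
  rfl

theorem shift_mul (x y : QL (α × ℕ)) : shift (x * y) = shift x * y + x * shift y := by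
  obtain ⟨x, rfl⟩ := mk_surjective x
  obtain ⟨y, rfl⟩ := mk_surjective y
  rw [← map_mul]
  exact shiftFree_mul x y

end QL

/-- The split extension of `QL (α × ℕ)` by the free quasi-Lie ring on one generator `t`
(spanned by `t` and `[t, t]`), with `t` acting as the shift derivation. -/
@[ext]
structure ShiftExt (α : Type) : Type where
  /-- The coefficient of `t`. -/
  lin : ZMod 2
  /-- The coefficient of `[t, t]`. -/
  sq : ZMod 2
  /-- The component in `QL (α × ℕ)`. -/
  rest : QL (α × ℕ)

namespace ShiftExt

variable {α : Type}

/-- The underlying product. -/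
def equivProd : ShiftExt α ≃ ZMod 2 × ZMod 2 × QL (α × ℕ) where
  toFun x := (x.lin, x.sq, x.rest)
  invFun x := ⟨x.1, x.2.1, x.2.2⟩
  left_inv _ := rfl
  right_inv _ := rfl

instance : AddCommGroup (ShiftExt α) := equivProd.addCommGroup

instance : Mul (ShiftExt α) where
  mul x y := ⟨0, x.lin * y.lin,
    x.lin • QL.shift y.rest + y.lin • QL.shift x.rest + x.rest * y.rest⟩

@[simp] theorem zero_lin : (0 : ShiftExt α).lin = 0 := rfl
@[simp] theorem zero_sq : (0 : ShiftExt α).sq = 0 := rfl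
@[simp] theorem zero_rest : (0 : ShiftExt α).rest = 0 := rfl
@[simp] theorem add_lin (x y : ShiftExt α) : (x + y).lin = x.lin + y.lin := rfl
@[simp] theorem add_sq (x y : ShiftExt α) : (x + y).sq = x.sq + y.sq := rfl
@[simp] theorem add_rest (x y : ShiftExt α) : (x + y).rest = x.rest + y.rest := rfl
@[simp] theorem mul_lin (x y : ShiftExt α) : (x * y).lin = 0 := rfl
@[simp] theorem mul_sq (x y : ShiftExt α) : (x * y).sq = x.lin * y.lin := rfl
@[simp] theorem mul_rest (x y : ShiftExt α) : (x * y).rest =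
    x.lin • QL.shift y.rest + y.lin • QL.shift x.rest + x.rest * y.rest := rfl

instance : NonUnitalNonAssocRing (ShiftExt α) where
  left_distrib x y z := by
    ext <;> simp [mul_add, add_smul]
    abel
  right_distrib x y z := by
    ext <;> simp [add_mul, add_smul]
    abel
  zero_mul x := by ext <;> simp
  mul_zero x := by ext <;> simp

instance : IsQuasiLieTwo (ShiftExt α) where
  add_self x := by ext <;> simp [CharTwo.add_self_eq_zero, QL.add_self]
  mul_comm x y := by
    ext
    · simp
    · simp [mul_comm]
    · simp only [mul_rest, IsQuasiLieTwo.mul_comm x.rest]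
      abel
  jacobi x y z := by
    ext
    · simp
    · simp
    · simp only [add_rest, mul_rest, mul_lin, zero_smul, add_zero, zero_add, smul_add,
        smul_mul_assoc, mul_smul_comm, ZMod.map_smul, map_add, add_mul, mul_add, QL.shift_mul]
      rw [← QL.add_eq_zero, IsQuasiLieTwo.jacobi x.rest,
        IsQuasiLieTwo.mul_comm y.rest (QL.shift x.rest), smul_comm y.lin x.lin,
        smul_comm z.lin x.lin, smul_comm z.lin y.lin]
      abel_nf
      simp only [two_zsmul, QL.add_self, add_zero]

end ShiftExt

namespace QL

variable {α : Type}

open Classical in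
/-- The elimination homomorphism singling out the generator `o`. -/
noncomputable def elim (o : α) : QL α →ₙ+* ShiftExt α :=
  lift fun a => if a = o then ⟨1, 0, 0⟩ else ⟨0, 0, tree (.of (a, 0))⟩

/-- The homomorphism sending the generator `(a, n)` to the `n`-fold bracket of `a` with `o`. -/
def iterBracket (o : α) : QL (α × ℕ) →ₙ+* QL α :=
  lift fun p => (tree (.of o) * ·)^[p.2] (tree (.of p.1))

theorem iterBracket_shift (o : α) (x : QL (α × ℕ)) :
    iterBracket o (shift x) = tree (.of o) * iterBracket o x := by
  induction x using induction with
  | zero => simp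
  | add x y hx hy => rw [map_add, map_add, map_add, mul_add, hx, hy]
  | tree t =>
    induction t using FreeMagma.recOnMul with
    | ih1 p =>
      rw [shift_of, iterBracket, lift_tree, lift_tree, FreeMagma.lift_of, FreeMagma.lift_of,
        Function.iterate_succ_apply']
    | ih2 s t hs ht =>
      rw [map_mul, shift_mul, map_add, map_mul, map_mul, map_mul, hs, ht,
        IsQuasiLieTwo.jacobi (tree (.of o))]

/-- The left inverse of the elimination homomorphism. -/
def assemble (o : α) (s : ShiftExt α) : QL α :=
  s.lin • tree (.of o) + s.sq • (tree (.of o) * tree (.of o)) + iterBracket o s.rest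

theorem assemble_add (o : α) (s t : ShiftExt α) :
    assemble o (s + t) = assemble o s + assemble o t := by
  simp only [assemble, ShiftExt.add_lin, ShiftExt.add_sq, ShiftExt.add_rest, add_smul, map_add]
  abel

theorem assemble_mul (o : α) (s t : ShiftExt α) :
    assemble o (s * t) = assemble o s * assemble o t := by
  have h (x : QL α) : tree (.of o) * tree (.of o) * x = 0 := by
    rw [IsQuasiLieTwo.mul_comm, IsQuasiLieTwo.mul_square]
  simp only [assemble, ShiftExt.mul_lin, ShiftExt.mul_sq, ShiftExt.mul_rest, zero_smul, zero_add,
    map_add, ZMod.map_smul, iterBracket_shift, map_mul, add_mul, mul_add, smul_mul_assoc,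
    mul_smul_comm, h, IsQuasiLieTwo.mul_square, smul_zero, add_zero, smul_add]
  rw [IsQuasiLieTwo.mul_comm (iterBracket o s.rest) (tree (.of o)), smul_smul,
    mul_comm t.lin s.lin]
  abel

theorem assemble_elim (o : α) (x : QL α) : assemble o (elim o x) = x := by
  induction x using induction with
  | zero => simp [assemble]
  | add x y hx hy => rw [map_add, assemble_add, hx, hy]
  | tree t =>
    induction t using FreeMagma.recOnMul with
    | ih1 a =>
      rw [elim, lift_tree, FreeMagma.lift_of]
      split_ifs with h
      · simp [assemble, h]
      · simp only [assemble, zero_smul, zero_add]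
        rw [iterBracket, lift_tree, FreeMagma.lift_of, Function.iterate_zero_apply]
    | ih2 s t hs ht => rw [map_mul, map_mul, assemble_mul, hs, ht]

theorem exists_eq_square_of_elim (o : α) {x : QL α} (hx : x * x = 0)
    (h : (elim o x).rest * (elim o x).rest = 0 → ∃ y, (elim o x).rest = y * y) :
    ∃ y, x = y * y := by
  have hsq : elim o x * elim o x = 0 := by rw [← map_mul, hx, map_zero]
  have hlin : (elim o x).lin = 0 := by
    simpa using congrArg ShiftExt.sq hsq
  have hrest : (elim o x).rest * (elim o x).rest = 0 := by
    simpa [hlin] using congrArg ShiftExt.rest hsq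
  obtain ⟨y, hy⟩ := h hrest
  have hs : (elim o x).sq * (elim o x).sq = (elim o x).sq := by
    generalize (elim o x).sq = a
    revert a
    decide
  refine ⟨(elim o x).sq • tree (.of o) + iterBracket o y, ?_⟩
  rw [IsQuasiLieTwo.add_mul_add_self, smul_mul_assoc, mul_smul_comm, smul_smul, hs,
    ← map_mul (iterBracket o), ← hy]
  nth_rw 1 [← assemble_elim o x]
  rw [assemble, hlin, zero_smul, zero_add]

/-- The span of the monomials of degree at most `n`. -/
def degLE (α : Type) (n : ℕ) : Submodule (ZMod 2) (QL α) :=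
  .span _ (tree '' {t | t.length ≤ n})

theorem tree_mem_degLE {t : FreeMagma α} {n : ℕ} (h : t.length ≤ n) : tree t ∈ degLE α n :=
  Submodule.subset_span ⟨t, h, rfl⟩

theorem degLE_mono {n n' : ℕ} (h : n ≤ n') : degLE α n ≤ degLE α n' :=
  Submodule.span_mono (Set.image_mono fun _ ht => le_trans ht h)

theorem mul_mem_degLE {x y : QL α} {n n' : ℕ} (hx : x ∈ degLE α n) (hy : y ∈ degLE α n') :
    x * y ∈ degLE α (n + n') := by
  induction hx using Submodule.span_induction with
  | zero => rw [zero_mul]; exact zero_mem _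
  | add x x' _ _ h h' => rw [add_mul]; exact add_mem h h'
  | smul a x _ h => rw [smul_mul_assoc]; exact Submodule.smul_mem _ _ h
  | mem x hx =>
    induction hy using Submodule.span_induction with
    | zero => rw [mul_zero]; exact zero_mem _
    | add x x' _ _ h h' => rw [mul_add]; exact add_mem h h'
    | smul a x _ h => rw [mul_smul_comm]; exact Submodule.smul_mem _ _ h
    | mem y hy =>
      obtain ⟨s, hs, rfl⟩ := hx
      obtain ⟨t, ht, rfl⟩ := hy
      rw [← map_mul]
      exact tree_mem_degLE (add_le_add hs ht)

theorem shift_mem_degLE {x : QL (α × ℕ)} {n : ℕ} (hx : x ∈ degLE (α × ℕ) n) :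
    shift x ∈ degLE (α × ℕ) n := by
  have key (t : FreeMagma (α × ℕ)) : shift (tree t) ∈ degLE (α × ℕ) t.length := by
    induction t using FreeMagma.recOnMul with
    | ih1 p => rw [shift_of]; exact tree_mem_degLE le_rfl
    | ih2 s t hs ht =>
      rw [map_mul, shift_mul]
      exact add_mem (mul_mem_degLE hs (tree_mem_degLE le_rfl))
        (mul_mem_degLE (tree_mem_degLE le_rfl) ht)
  induction hx using Submodule.span_induction with
  | zero => rw [map_zero]; exact zero_mem _
  | add x x' _ _ h h' => rw [map_add]; exact add_mem h h'
  | smul a x _ h => rw [ZMod.map_smul]; exact Submodule.smul_mem _ _ h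
  | mem x hx =>
    obtain ⟨t, ht, rfl⟩ := hx
    exact degLE_mono ht (key t)

open Classical in
/-- The letters occurring in a monomial. -/
noncomputable def letters : FreeMagma α → Finset α
  | .of a => {a}
  | .mul s t => letters s ∪ letters t

open Classical in
/-- The number of letters of a monomial different from `o`, counted with multiplicity. -/
noncomputable def degAway (o : α) : FreeMagma α → ℕ
  | .of a => if a = o then 0 else 1
  | .mul s t => degAway o s + degAway o t

theorem degAway_le (o : α) (t : FreeMagma α) : degAway o t ≤ t.length := by
  induction t using FreeMagma.recOnMul with
  | ih1 a => simp only [degAway, FreeMagma.length]; split_ifs <;> simp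
  | ih2 s t hs ht => exact add_le_add hs ht

open Classical in
theorem degAway_lt {o : α} {t : FreeMagma α} (h : o ∈ letters t) : degAway o t < t.length := by
  induction t using FreeMagma.recOnMul with
  | ih1 a => simp_all [degAway, FreeMagma.length, letters]
  | ih2 s t hs ht =>
    rcases Finset.mem_union.1 h with h | h
    · exact add_lt_add_of_lt_of_le (hs h) (degAway_le o t)
    · exact add_lt_add_of_le_of_lt (degAway_le o s) (ht h)

open Classical in
theorem letters_nonempty (t : FreeMagma α) : (letters t).Nonempty := by
  induction t using FreeMagma.recOnMul with
  | ih1 a => exact Finset.singleton_nonempty a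
  | ih2 s t hs ht => exact hs.imp fun _ h => Finset.mem_union_left _ h

theorem elim_tree_rest_mem (o : α) (t : FreeMagma α) :
    (elim o (tree t)).rest ∈ degLE (α × ℕ) (degAway o t) := by
  induction t using FreeMagma.recOnMul with
  | ih1 a =>
    rw [elim, lift_tree, FreeMagma.lift_of]
    simp only [degAway]
    split_ifs
    · exact zero_mem _
    · exact tree_mem_degLE le_rfl
  | ih2 s t hs ht =>
    rw [map_mul, map_mul, ShiftExt.mul_rest]
    refine add_mem (add_mem (Submodule.smul_mem _ _ ?_) (Submodule.smul_mem _ _ ?_))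
      (mul_mem_degLE hs ht)
    · exact degLE_mono (Nat.le_add_left _ _) (shift_mem_degLE ht)
    · exact degLE_mono (Nat.le_add_right _ _) (shift_mem_degLE hs)

open Classical in
theorem elim_tree_of_notMem {o : α} {t : FreeMagma α} (h : o ∉ letters t) :
    elim o (tree t) = ⟨0, 0, tree (FreeMagma.map (fun a => (a, 0)) t)⟩ := by
  induction t using FreeMagma.recOnMul with
  | ih1 a =>
    rw [elim, lift_tree, FreeMagma.lift_of, if_neg fun ha => h (by simp [letters, ha])]
    rfl
  | ih2 s t hs ht =>
    have hs := hs fun h' => h (Finset.mem_union_left _ h')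
    have ht := ht fun h' => h (Finset.mem_union_right _ h')
    rw [map_mul, map_mul, hs, ht]
    ext <;> simp

theorem length_map {β : Type} (f : α → β) (t : FreeMagma α) :
    (FreeMagma.map f t).length = t.length := by
  induction t using FreeMagma.recOnMul with
  | ih1 a => rfl
  | ih2 s t hs ht => exact congrArg₂ (· + ·) hs ht

open Classical in
theorem exists_of_mem_letters_map {β : Type} {f : α → β} {t : FreeMagma α} {b : β}
    (hb : b ∈ letters (FreeMagma.map f t)) : ∃ a ∈ letters t, f a = b := by
  induction t using FreeMagma.recOnMul with
  | ih1 a => exact ⟨a, Finset.mem_singleton_self a, (Finset.mem_singleton.1 hb).symm⟩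
  | ih2 s t hs ht =>
    rw [map_mul] at hb
    rcases Finset.mem_union.1 hb with hb | hb
    · exact (hs hb).imp fun a ha => ⟨Finset.mem_union_left _ ha.1, ha.2⟩
    · exact (ht hb).imp fun a ha => ⟨Finset.mem_union_right _ ha.1, ha.2⟩

/-- The span of the monomials of degree less than `n`, and of those of degree `n` whose letters
lie in `O`. -/
def degLEOn (n : ℕ) (O : Finset α) : Submodule (ZMod 2) (QL α) :=
  .span _ (tree '' {t | t.length < n ∨ t.length = n ∧ letters t ⊆ O})

theorem degLEOn_mono {n : ℕ} {O O' : Finset α} (h : O ⊆ O') : degLEOn n O ≤ degLEOn n O' :=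
  Submodule.span_mono (Set.image_mono fun _ ht => ht.imp_right fun ht => ⟨ht.1, ht.2.trans h⟩)

theorem exists_mem_degLEOn {n : ℕ} {x : QL α} (hx : x ∈ degLE α n) : ∃ O, x ∈ degLEOn n O := by
  classical
  induction hx using Submodule.span_induction with
  | zero => exact ⟨∅, zero_mem _⟩
  | add x x' _ _ h h' =>
    obtain ⟨O, h⟩ := h
    obtain ⟨O', h'⟩ := h'
    exact ⟨O ∪ O', add_mem (degLEOn_mono Finset.subset_union_left h)
      (degLEOn_mono Finset.subset_union_right h')⟩
  | smul a x _ h => exact h.imp fun O h => Submodule.smul_mem _ _ h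
  | mem x hx =>
    obtain ⟨t, ht, rfl⟩ := hx
    refine ⟨letters t, Submodule.subset_span ⟨t, ?_, rfl⟩⟩
    exact (lt_or_eq_of_le ht).imp_right fun h => ⟨h, subset_rfl⟩

theorem degLEOn_empty_le (n : ℕ) : degLEOn (n + 1) (∅ : Finset α) ≤ degLE α n := by
  refine Submodule.span_mono (Set.image_mono ?_)
  rintro t (ht | ⟨-, ht⟩)
  · exact Nat.lt_succ_iff.1 ht
  · exact absurd (Finset.subset_empty.1 ht) (letters_nonempty t).ne_empty

open Classical in
theorem elim_rest_mem_degLEOn {n : ℕ} {O : Finset α} (o : α) {x : QL α} (hx : x ∈ degLEOn n O) :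
    (elim o x).rest ∈ degLEOn n ((O.erase o).map (.sectL α 0)) := by
  induction hx using Submodule.span_induction with
  | zero => rw [map_zero]; exact zero_mem _
  | add x x' _ _ h h' => rw [map_add]; exact add_mem h h'
  | smul a x _ h =>
    obtain rfl | rfl : a = 0 ∨ a = 1 := by revert a; decide
    · rw [zero_smul, map_zero]; exact zero_mem _
    · rwa [one_smul]
  | mem x hx =>
    obtain ⟨t, ht, rfl⟩ := hx
    by_cases ho : o ∈ letters t
    · have hlt : degAway o t < n :=
        (degAway_lt ho).trans_le (ht.elim le_of_lt fun h => h.1.le)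
      refine Submodule.span_mono (Set.image_mono ?_) (elim_tree_rest_mem o t)
      exact fun s hs => Or.inl (lt_of_le_of_lt hs hlt)
    · rw [elim_tree_of_notMem ho]
      refine Submodule.subset_span ⟨_, ?_, rfl⟩
      rw [Set.mem_ofPred_eq, length_map]
      refine ht.imp_right fun h => ⟨h.1, fun b hb => ?_⟩
      obtain ⟨a, ha, rfl⟩ := exists_of_mem_letters_map hb
      refine Finset.mem_map.2 ⟨a, ?_, rfl⟩
      exact Finset.mem_erase.2 ⟨fun h => ho (h ▸ ha), h.2 ha⟩

theorem exists_eq_square_of_mem_degLE (n : ℕ) :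
    ∀ {α : Type} {x : QL α}, x ∈ degLE α n → x * x = 0 → ∃ y, x = y * y := by
  induction n with
  | zero =>
    intro α x hx _
    have : {t : FreeMagma α | t.length ≤ 0} = ∅ :=
      Set.eq_empty_of_forall_notMem fun t ht => t.length_pos.not_ge ht
    rw [degLE, this, Set.image_empty, Submodule.span_empty, Submodule.mem_bot] at hx
    exact ⟨0, by rw [hx, mul_zero]⟩
  | succ n ih =>
    have key (j : ℕ) : ∀ {α : Type} (O : Finset α) {x : QL α}, O.card = j →
        x ∈ degLEOn (n + 1) O → x * x = 0 → ∃ y, x = y * y := by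
      classical
      induction j with
      | zero =>
        intro α O x hO hx
        rw [Finset.card_eq_zero.1 hO] at hx
        exact ih (degLEOn_empty_le n hx)
      | succ j ihj =>
        intro α O x hO hx hsq
        obtain ⟨o, ho⟩ : O.Nonempty := Finset.card_pos.1 (by omega)
        refine exists_eq_square_of_elim o hsq (ihj _ ?_ (elim_rest_mem_degLEOn o hx))
        rw [Finset.card_map, Finset.card_erase_of_mem ho, hO, Nat.add_sub_cancel]
    intro α x hx
    obtain ⟨O, hO⟩ := exists_mem_degLEOn hx
    exact key _ O rfl hO

/-- An element of square zero in a free quasi-Lie ring of characteristic two is a square. -/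
theorem exists_eq_square {x : QL α} (hx : x * x = 0) : ∃ y, x = y * y := by
  obtain ⟨n, hn⟩ : ∃ n, x ∈ degLE α n := by
    clear hx
    induction x using induction with
    | zero => exact ⟨0, zero_mem _⟩
    | tree t => exact ⟨t.length, tree_mem_degLE le_rfl⟩
    | add x y hx hy =>
      obtain ⟨n, hn⟩ := hx
      obtain ⟨n', hn'⟩ := hy
      exact ⟨n + n', add_mem (degLE_mono (Nat.le_add_right _ _) hn)
        (degLE_mono (Nat.le_add_left _ _) hn')⟩
  exact exists_eq_square_of_mem_degLE n hn hx

end QL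

namespace RTree

variable {m : ℕ}

/-- The rooted tree of a monomial. -/
def ofMagma : FreeMagma (Fin m) → RTree m
  | .of i => leaf i
  | .mul s t => node (ofMagma s) (ofMagma t)

/-- The monomial of a rooted tree. -/
def toMagma : RTree m → FreeMagma (Fin m)
  | leaf i => .of i
  | node a b => a.toMagma * b.toMagma

theorem ofMagma_toMagma (t : RTree m) : ofMagma t.toMagma = t := by
  induction t with
  | leaf i => rfl
  | node a b ha hb => exact congrArg₂ node ha hb

theorem toMagma_ofMagma (t : FreeMagma (Fin m)) : (ofMagma t).toMagma = t := by
  induction t using FreeMagma.recOnMul with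
  | ih1 i => rfl
  | ih2 s t hs ht => exact congrArg₂ (· * ·) hs ht

theorem ofMagma_mul (s t : FreeMagma (Fin m)) :
    ofMagma (s * t) = node (ofMagma s) (ofMagma t) := rfl

/-- The class of a rooted tree in the free quasi-Lie ring of characteristic two. -/
def bracket (t : RTree m) : QL (Fin m) := QL.tree t.toMagma

theorem bracket_node (a b : RTree m) : (node a b).bracket = a.bracket * b.bracket :=
  map_mul QL.tree _ _

theorem bracket_ofMagma (t : FreeMagma (Fin m)) : (ofMagma t).bracket = QL.tree t :=
  congrArg QL.tree (toMagma_ofMagma t)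

end RTree

namespace Ctx

variable {m : ℕ}

/-- Composition of contexts. -/
def comp : Ctx m → Ctx m → Ctx m
  | .hole, d => d
  | .nodeL c r, d => .nodeL (c.comp d) r
  | .nodeR l c, d => .nodeR l (c.comp d)

theorem fill_comp (c d : Ctx m) (t : RTree m) : (c.comp d).fill t = c.fill (d.fill t) := by
  induction c with
  | hole => rfl
  | nodeL c r h => exact congrArg (RTree.node · r) h
  | nodeR l c h => exact congrArg (RTree.node l) h

theorem deg_fill_congr (c : Ctx m) {s t : RTree m} (h : s.deg = t.deg) :
    (c.fill s).deg = (c.fill t).deg := by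
  induction c with
  | hole => exact h
  | nodeL c r hc => exact congrArg (· + r.deg) hc
  | nodeR l c hc => exact congrArg (l.deg + ·) hc

/-- The additive operator on the free quasi-Lie ring of characteristic two given by a context. -/
def act : Ctx m → QL (Fin m) →+ QL (Fin m)
  | .hole => .id _
  | .nodeL c r => (AddMonoidHom.mulRight r.bracket).comp c.act
  | .nodeR l c => (AddMonoidHom.mulLeft l.bracket).comp c.act

theorem bracket_fill (c : Ctx m) (t : RTree m) : (c.fill t).bracket = c.act t.bracket := by
  induction c with
  | hole => rfl
  | nodeL c r h => exact (RTree.bracket_node _ _).trans (congrArg (· * r.bracket) h)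
  | nodeR l c h => exact (RTree.bracket_node _ _).trans (congrArg (l.bracket * ·) h)

end Ctx

namespace QL

variable {m : ℕ}

@[elab_as_elim]
theorem rtree_induction {P : QL (Fin m) → Prop} (zero : P 0) (bracket : ∀ t : RTree m, P t.bracket)
    (add : ∀ x y, P x → P y → P (x + y)) (x : QL (Fin m)) : P x := by
  induction x using induction with
  | zero => exact zero
  | tree t => rw [← RTree.bracket_ofMagma]; exact bracket _
  | add x y hx hy => exact add x y hx hy

/-- The class of a rooted tree if its degree is `n`, and zero otherwise. -/
def gradedBracket (n : ℕ) : FreeAbelianGroup (RTree m) →+ QL (Fin m) :=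
  FreeAbelianGroup.lift fun t => if t.deg = n then t.bracket else 0

theorem gradedBracket_of (n : ℕ) (t : RTree m) :
    gradedBracket n (.of t) = if t.deg = n then t.bracket else 0 :=
  FreeAbelianGroup.lift_apply_of _ _

theorem closure_quasiLieRels_le (n : ℕ) :
    AddSubgroup.closure (quasiLieRels m n) ≤ (gradedBracket n).ker := by
  rw [AddSubgroup.closure_le]
  rintro x ((⟨J, hJ, rfl⟩ | ⟨c, A, B, rfl⟩) | ⟨c, A, B, C, rfl⟩) <;>
    simp only [SetLike.mem_coe, AddMonoidHom.mem_ker, map_add, map_sub, gradedBracket_of]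
  · rw [if_neg hJ]
  · rw [c.deg_fill_congr (s := .node B A) (t := .node A B) (Nat.add_comm _ _)]
    split_ifs
    · rw [c.bracket_fill, c.bracket_fill, RTree.bracket_node, RTree.bracket_node,
        IsQuasiLieTwo.mul_comm, add_self]
    · exact add_zero 0
  · rw [c.deg_fill_congr (s := .node (.node A B) C) (t := .node A (.node B C)) (add_assoc _ _ _),
      c.deg_fill_congr (s := .node B (.node A C)) (t := .node A (.node B C))
        (Nat.add_left_comm _ _ _)]
    split_ifs
    · simp only [c.bracket_fill, RTree.bracket_node]
      rw [IsQuasiLieTwo.jacobi A.bracket, map_add]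
      abel
    · simp

/-- The inclusion of the degree `n` part of the free quasi-Lie ring tensored with `ZMod 2`. -/
noncomputable def ofLp (m n : ℕ) : ZMod 2 ⊗[ℤ] Lp m n →+ QL (Fin m) :=
  TensorProduct.liftAddHom
    ((smulAddHom (ZMod 2) (QL (Fin m))).compl₂
      (QuotientAddGroup.lift _ (gradedBracket n) (closure_quasiLieRels_le n)))
    fun r a x => by rw [map_zsmul, map_zsmul]; rfl

theorem ofLp_tmul (n : ℕ) (a : ZMod 2) (t : RTree m) :
    ofLp m n (a ⊗ₜ LpMk m n (.of t)) = a • if t.deg = n then t.bracket else 0 :=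
  congrArg (a • ·) (gradedBracket_of n t)

theorem tmul_add_self {N : Type*} [AddCommGroup N] (x : ZMod 2 ⊗[ℤ] N) : x + x = 0 := by
  induction x with
  | zero => exact add_zero 0
  | add x y hx hy => rw [add_add_add_comm, hx, hy, add_zero]
  | tmul a x => rw [← TensorProduct.add_tmul, CharTwo.add_self_eq_zero, TensorProduct.zero_tmul]

/-- The degree `n` part of a monomial placed in a context. -/
noncomputable def fillLp (n : ℕ) (c : Ctx m) : FreeNonAssoc (Fin m) →+ ZMod 2 ⊗[ℤ] Lp m n :=
  FreeAbelianGroup.lift fun t => 1 ⊗ₜ LpMk m n (.of (c.fill (RTree.ofMagma t)))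

theorem fillLp_of (n : ℕ) (c : Ctx m) (t : FreeMagma (Fin m)) :
    fillLp n c (.of t) = 1 ⊗ₜ LpMk m n (.of (c.fill (RTree.ofMagma t))) :=
  FreeAbelianGroup.lift_apply_of _ _

theorem fillLp_mul_of (n : ℕ) (c : Ctx m) (x : FreeNonAssoc (Fin m)) (t : FreeMagma (Fin m)) :
    fillLp n c (x * .of t) = fillLp n (c.comp (.nodeL .hole (RTree.ofMagma t))) x := by
  induction x using FreeAbelianGroup.induction_on with
  | zero => rw [zero_mul, map_zero, map_zero]
  | of s => rw [FreeAbelianGroup.of_mul_of, fillLp_of, fillLp_of, Ctx.fill_comp]; rfl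
  | neg s h => rw [neg_mul, map_neg, map_neg, h]
  | add x y hx hy => rw [add_mul, map_add, map_add, hx, hy]

theorem fillLp_of_mul (n : ℕ) (c : Ctx m) (x : FreeNonAssoc (Fin m)) (t : FreeMagma (Fin m)) :
    fillLp n c (.of t * x) = fillLp n (c.comp (.nodeR (RTree.ofMagma t) .hole)) x := by
  induction x using FreeAbelianGroup.induction_on with
  | zero => rw [mul_zero, map_zero, map_zero]
  | of s => rw [FreeAbelianGroup.of_mul_of, fillLp_of, fillLp_of, Ctx.fill_comp]; rfl
  | neg s h => rw [mul_neg, map_neg, map_neg, h]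
  | add x y hx hy => rw [mul_add, map_add, map_add, hx, hy]

/-- The ideal of elements whose degree `n` part vanishes in every context. -/
noncomputable def fillIdeal (m n : ℕ) : TwoSidedIdeal (FreeNonAssoc (Fin m)) :=
  .mk' {x | ∀ c, fillLp n c x = 0} (fun c => map_zero _)
    (fun h h' c => by rw [map_add, h, h', add_zero]) (fun h c => by rw [map_neg, h, neg_zero])
    (fun {x y} h c => by
      induction x using FreeAbelianGroup.induction_on with
      | zero => rw [zero_mul, map_zero]
      | of t => rw [fillLp_of_mul, h]
      | neg s h => rw [neg_mul, map_neg, h, neg_zero]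
      | add x y hx hy => rw [add_mul, map_add, hx, hy, add_zero])
    (fun {x y} h c => by
      induction y using FreeAbelianGroup.induction_on with
      | zero => rw [mul_zero, map_zero]
      | of t => rw [fillLp_mul_of, h]
      | neg s h => rw [mul_neg, map_neg, h, neg_zero]
      | add x y hx hy => rw [mul_add, map_add, hx, hy, add_zero])

theorem mem_fillIdeal {n : ℕ} {x : FreeNonAssoc (Fin m)} :
    x ∈ fillIdeal m n ↔ ∀ c, fillLp n c x = 0 := TwoSidedIdeal.mem_mk' ..

theorem LpMk_eq_zero {n : ℕ} {x : FreeAbelianGroup (RTree m)} (hx : x ∈ quasiLieRels m n) :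
    LpMk m n x = 0 :=
  (QuotientAddGroup.eq_zero_iff _).2 (AddSubgroup.subset_closure hx)

theorem qlRels_subset_fillIdeal (n : ℕ) : qlRels (Fin m) ⊆ fillIdeal m n := by
  intro x hx
  refine mem_fillIdeal.2 fun c => ?_
  obtain (⟨a, rfl⟩ | ⟨a, b, rfl⟩) | ⟨a, b, d, rfl⟩ := hx
  · rw [map_add, tmul_add_self]
  · simp only [map_add, fillLp_of, RTree.ofMagma_mul]
    rw [← TensorProduct.tmul_add, ← map_add, LpMk_eq_zero (Or.inl (Or.inr ⟨c, _, _, rfl⟩)),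
      TensorProduct.tmul_zero]
  · have h := LpMk_eq_zero (n := n) (Or.inr ⟨c, RTree.ofMagma a, RTree.ofMagma b,
      RTree.ofMagma d, rfl⟩)
    rw [map_sub, map_sub, sub_sub, sub_eq_zero] at h
    simp only [map_add, fillLp_of, RTree.ofMagma_mul]
    rw [h, TensorProduct.tmul_add, add_assoc, tmul_add_self]

/-- The projection onto the degree `n` part. -/
noncomputable def toLp (m n : ℕ) : QL (Fin m) →+ ZMod 2 ⊗[ℤ] Lp m n :=
  liftAdd (fillLp n .hole) (fillIdeal m n) (qlRels_subset_fillIdeal n)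
    fun _ h => mem_fillIdeal.1 h _

theorem toLp_bracket (n : ℕ) (t : RTree m) : toLp m n t.bracket = 1 ⊗ₜ LpMk m n (.of t) := by
  rw [toLp, RTree.bracket, liftAdd_tree, fillLp_of, RTree.ofMagma_toMagma]
  rfl

theorem toLp_bracket_of_ne {n : ℕ} {t : RTree m} (h : t.deg ≠ n) : toLp m n t.bracket = 0 := by
  rw [toLp_bracket, LpMk_eq_zero (Or.inl (Or.inl ⟨t, h, rfl⟩)), TensorProduct.tmul_zero]

theorem toLp_ofLp (n : ℕ) (x : ZMod 2 ⊗[ℤ] Lp m n) : toLp m n (ofLp m n x) = x := by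
  induction x with
  | zero => rw [map_zero, map_zero]
  | add x y hx hy => rw [map_add, map_add, hx, hy]
  | tmul a x =>
    obtain ⟨x, rfl⟩ := QuotientAddGroup.mk'_surjective _ x
    induction x using FreeAbelianGroup.induction_on with
    | zero => rw [map_zero, TensorProduct.tmul_zero, map_zero, map_zero]
    | neg t h => rw [map_neg, TensorProduct.tmul_neg, map_neg, map_neg, h]
    | add x y hx hy => rw [map_add, TensorProduct.tmul_add, map_add, map_add, hx, hy]
    | of t =>
      rw [ofLp_tmul]
      obtain rfl | rfl : a = 0 ∨ a = 1 := by revert a; decide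
      · rw [zero_smul, map_zero, TensorProduct.zero_tmul]
      · rw [one_smul]
        split_ifs with h
        · exact toLp_bracket n t
        · rw [map_zero, LpMk_eq_zero (Or.inl (Or.inl ⟨t, h, rfl⟩)), TensorProduct.tmul_zero]

/-- The projection of the free quasi-Lie ring of characteristic two onto its degree `n` part. -/
noncomputable def degreePart (n : ℕ) : QL (Fin m) →+ QL (Fin m) := (ofLp m n).comp (toLp m n)

theorem degreePart_bracket (n : ℕ) (t : RTree m) :
    degreePart n t.bracket = if t.deg = n then t.bracket else 0 := by
  rw [degreePart, AddMonoidHom.comp_apply, toLp_bracket, ofLp_tmul, one_smul]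

theorem toLp_mul_degreePart (k : ℕ) (i : Fin m) (x : QL (Fin m)) :
    toLp m (k + 1) ((RTree.leaf i).bracket * degreePart k x) =
      toLp m (k + 1) ((RTree.leaf i).bracket * x) := by
  induction x using rtree_induction with
  | zero => rw [map_zero]
  | add x y hx hy => rw [map_add, mul_add, mul_add, map_add, map_add, hx, hy]
  | bracket t =>
    rw [degreePart_bracket]
    split_ifs with h
    · rfl
    · rw [mul_zero, map_zero, ← RTree.bracket_node, toLp_bracket_of_ne]
      simp only [RTree.deg]
      omega

end QL

namespace QL

variable {m : ℕ}

/-- Auxiliary definition of `reroot` on the free nonassociative ring. -/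
def rerootFree : FreeNonAssoc (Fin m) →+ QL (Fin m) →+ Fin m → QL (Fin m) :=
  FreeAbelianGroup.lift fun t =>
    FreeMagma.recOnMul (C := fun _ => QL (Fin m) →+ Fin m → QL (Fin m)) t
      (AddMonoidHom.single fun _ => QL (Fin m)) fun s t ds dt =>
        ds.comp (AddMonoidHom.mulLeft (tree t)) + dt.comp (AddMonoidHom.mulRight (tree s))

theorem rerootFree_mul (x y : FreeNonAssoc (Fin m)) (z : QL (Fin m)) :
    rerootFree (x * y) z = rerootFree x (mk y * z) + rerootFree y (z * mk x) := by
  induction x using FreeAbelianGroup.induction_on with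
  | zero => simp
  | neg s h => simp only [neg_mul, map_neg, AddMonoidHom.neg_apply, mul_neg, h]; abel
  | add x x' h h' => simp only [add_mul, map_add, AddMonoidHom.add_apply, mul_add, h, h']; abel
  | of s =>
    induction y using FreeAbelianGroup.induction_on with
    | zero => simp
    | neg s h => simp only [neg_mul, map_neg, AddMonoidHom.neg_apply, mul_neg, h]; abel
    | add x x' h h' => simp only [add_mul, map_add, AddMonoidHom.add_apply, mul_add, h, h']; abel
    | of t =>
      rw [FreeAbelianGroup.of_mul_of]
      simp only [rerootFree, FreeAbelianGroup.lift_apply_of]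
      rfl

theorem pi_add_self (f : Fin m → QL (Fin m)) : f + f = 0 := funext fun i => add_self (f i)

theorem rerootFree_qlRels {x : FreeNonAssoc (Fin m)} (hx : x ∈ qlRels (Fin m)) :
    rerootFree x = 0 := by
  ext1 z
  obtain (⟨a, rfl⟩ | ⟨a, b, rfl⟩) | ⟨a, b, c, rfl⟩ := hx
  · rw [map_add, AddMonoidHom.add_apply, pi_add_self]; rfl
  · simp only [map_add, AddMonoidHom.add_apply, ← FreeAbelianGroup.of_mul_of, rerootFree_mul]
    rw [IsQuasiLieTwo.mul_comm z, IsQuasiLieTwo.mul_comm z, add_comm (rerootFree (.of b) _),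
      pi_add_self]
    rfl
  · simp only [map_add, AddMonoidHom.add_apply, ← FreeAbelianGroup.of_mul_of, rerootFree_mul,
      map_mul, mk_of]
    generalize tree a = a', tree b = b', tree c = c'
    have ha : b' * c' * z + b' * (c' * z) + c' * (z * b') = 0 := by
      rw [← IsQuasiLieTwo.jacobi_cyclic b' c' z, IsQuasiLieTwo.mul_comm z (b' * c')]
      abel
    have hb : c' * (z * a') + c' * z * a' + a' * c' * z = 0 := by
      rw [← IsQuasiLieTwo.jacobi_cyclic a' c' z, IsQuasiLieTwo.mul_comm z (a' * c'),
        IsQuasiLieTwo.mul_comm a' (c' * z)]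
      abel
    have hc : z * a' * b' + z * (a' * b') + z * b' * a' = 0 := by
      rw [← IsQuasiLieTwo.jacobi_cyclic a' b' z, IsQuasiLieTwo.mul_comm (z * a') b',
        IsQuasiLieTwo.mul_comm (z * b') a', IsQuasiLieTwo.mul_comm z b']
      abel
    calc _ = rerootFree (.of a) (b' * c' * z + b' * (c' * z) + c' * (z * b')) +
          rerootFree (.of b) (c' * (z * a') + c' * z * a' + a' * c' * z) +
          rerootFree (.of c) (z * a' * b' + z * (a' * b') + z * b' * a') := by
            simp only [map_add]
            abel
      _ = 0 := by rw [ha, hb, hc, map_zero, map_zero, map_zero, add_zero, add_zero]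

/-- The sum over the letters `v` of `x` of the tree obtained from `⟨x, z⟩` by rooting at `v`,
placed in the component of the label of `v`. -/
def reroot : QL (Fin m) →+ QL (Fin m) →+ Fin m → QL (Fin m) :=
  liftAddOfMul rerootFree (fun _ => rerootFree_qlRels)
    (fun x y h h' => by
      ext1 z
      rw [rerootFree_mul, h, h', mul_zero, map_zero, AddMonoidHom.zero_apply, add_zero]
      rfl)
    (fun x y h h' => by
      ext1 z
      rw [rerootFree_mul, h, h', zero_mul, map_zero, AddMonoidHom.zero_apply, zero_add]
      rfl)

theorem reroot_leaf (i : Fin m) (z : QL (Fin m)) :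
    reroot (RTree.leaf i).bracket z = Pi.single i z := by
  rw [reroot, RTree.bracket, liftAddOfMul_tree, rerootFree, FreeAbelianGroup.lift_apply_of]
  rfl

theorem reroot_mul (x y z : QL (Fin m)) :
    reroot (x * y) z = reroot x (y * z) + reroot y (z * x) := by
  obtain ⟨x, rfl⟩ := mk_surjective x
  obtain ⟨y, rfl⟩ := mk_surjective y
  rw [← map_mul]
  exact rerootFree_mul x y z

/-- The sum of all the rootings of `⟨x, y⟩`. -/
def rootings : QL (Fin m) →+ QL (Fin m) →+ Fin m → QL (Fin m) := reroot + reroot.flip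

theorem rootings_apply (x y : QL (Fin m)) : rootings x y = reroot x y + reroot y x := rfl

theorem rootings_comm (x y : QL (Fin m)) : rootings x y = rootings y x := by
  rw [rootings_apply, rootings_apply, add_comm]

theorem rootings_mul_left (x y z : QL (Fin m)) : rootings (x * y) z = rootings x (y * z) := by
  rw [rootings_apply, rootings_apply, reroot_mul, reroot_mul, add_assoc]

theorem rootings_leaf_square (i : Fin m) (x : QL (Fin m)) :
    rootings (RTree.leaf i).bracket (x * x) = Pi.single i (x * x) := by
  rw [rootings_apply, reroot_leaf, reroot_mul,
    IsQuasiLieTwo.mul_comm x (RTree.leaf i).bracket, pi_add_self, add_zero]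

/-- The bracket map `∑ X_i ⊗ z_i ↦ ∑ [X_i, z_i]`. -/
def bracketSum : (Fin m → QL (Fin m)) →+ QL (Fin m) :=
  ∑ i, (AddMonoidHom.mulLeft (RTree.leaf i).bracket).comp (Pi.evalAddMonoidHom _ i)

theorem bracketSum_apply (z : Fin m → QL (Fin m)) :
    bracketSum z = ∑ i, (RTree.leaf i).bracket * z i := by
  rw [bracketSum, AddMonoidHom.finsetSum_apply]
  rfl

theorem bracketSum_single (i : Fin m) (x : QL (Fin m)) :
    bracketSum (Pi.single i x) = (RTree.leaf i).bracket * x := by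
  rw [bracketSum_apply, Finset.sum_eq_single i, Pi.single_eq_same]
  · intro j _ hj
    rw [Pi.single_eq_of_ne hj, mul_zero]
  · exact fun h => absurd (Finset.mem_univ i) h

theorem bracketSum_reroot (x y : QL (Fin m)) : bracketSum (reroot x y) = x * y := by
  induction x using rtree_induction generalizing y with
  | zero => simp
  | add x x' h h' => rw [map_add, AddMonoidHom.add_apply, map_add, h, h', add_mul]
  | bracket t =>
    induction t generalizing y with
    | leaf i => rw [reroot_leaf, bracketSum_single]
    | node a b ha hb =>
      rw [RTree.bracket_node, reroot_mul, map_add, ha, hb, IsQuasiLieTwo.jacobi a.bracket,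
        IsQuasiLieTwo.mul_comm y, add_assoc, add_self, add_zero]

theorem bracketSum_rootings (x y : QL (Fin m)) : bracketSum (rootings x y) = 0 := by
  rw [rootings_apply, map_add, bracketSum_reroot, bracketSum_reroot, IsQuasiLieTwo.mul_comm,
    add_self]

theorem toLp_bracketSum_eq_zero {k : ℕ} {z : Fin m → QL (Fin m)}
    (h : ∀ i, degreePart k (z i) * degreePart k (z i) = 0) :
    toLp m (k + 1) (bracketSum z) = 0 := by
  rw [bracketSum_apply, map_sum]
  refine Finset.sum_eq_zero fun i _ => ?_
  obtain ⟨w, hw⟩ := exists_eq_square (h i)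
  rw [← toLp_mul_degreePart, hw, IsQuasiLieTwo.mul_square, map_zero]

end QL

namespace Tgrp

variable {m n : ℕ}

theorem mk_eq_zero {x : FreeAbelianGroup (RTree m × RTree m)} (hx : x ∈ treeRels m n) :
    TMk m n x = 0 :=
  (QuotientAddGroup.eq_zero_iff _).2 (AddSubgroup.subset_closure hx)

/-- The inner product of rooted trees, extended bilinearly. -/
def pairing (m n : ℕ) : FreeNonAssoc (Fin m) →+ FreeNonAssoc (Fin m) →+ Tgrp m n :=
  FreeAbelianGroup.lift fun s => FreeAbelianGroup.lift fun t =>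
    TMk m n (.of (RTree.ofMagma s, RTree.ofMagma t))

theorem pairing_of (s t : FreeMagma (Fin m)) :
    pairing m n (.of s) (.of t) = TMk m n (.of (RTree.ofMagma s, RTree.ofMagma t)) := by
  rw [pairing, FreeAbelianGroup.lift_apply_of, FreeAbelianGroup.lift_apply_of]

theorem pairing_comm (x y : FreeNonAssoc (Fin m)) : pairing m n x y = pairing m n y x := by
  induction x using FreeAbelianGroup.induction_on with
  | zero => simp
  | neg s h => rw [map_neg, map_neg, AddMonoidHom.neg_apply, h]
  | add x x' h h' => rw [map_add, map_add, AddMonoidHom.add_apply, h, h']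
  | of s =>
    induction y using FreeAbelianGroup.induction_on with
    | zero => simp
    | neg s h => rw [map_neg, map_neg, AddMonoidHom.neg_apply, h]
    | add x x' h h' => rw [map_add, map_add, AddMonoidHom.add_apply, h, h']
    | of t =>
      rw [pairing_of, pairing_of, ← sub_eq_zero, ← map_sub]
      exact mk_eq_zero (Or.inl (Or.inl (Or.inl (Or.inr ⟨_, _, rfl⟩))))

theorem pairing_mul_left (x y z : FreeNonAssoc (Fin m)) :
    pairing m n (x * y) z = pairing m n x (y * z) := by
  induction x using FreeAbelianGroup.induction_on with
  | zero => simp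
  | neg s h => rw [neg_mul, map_neg, map_neg, AddMonoidHom.neg_apply, AddMonoidHom.neg_apply, h]
  | add x x' h h' =>
    rw [add_mul, map_add, map_add, AddMonoidHom.add_apply, AddMonoidHom.add_apply, h, h']
  | of s =>
    induction y using FreeAbelianGroup.induction_on with
    | zero => simp
    | neg s h => rw [mul_neg, neg_mul, map_neg, map_neg, AddMonoidHom.neg_apply, h]
    | add x x' h h' => rw [mul_add, add_mul, map_add, map_add, AddMonoidHom.add_apply, h, h']
    | of t =>
      induction z using FreeAbelianGroup.induction_on with
      | zero => simp
      | neg s h => rw [mul_neg, map_neg, map_neg, h]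
      | add x x' h h' => rw [mul_add, map_add, map_add, h, h']
      | of u =>
        rw [FreeAbelianGroup.of_mul_of, FreeAbelianGroup.of_mul_of, pairing_of, pairing_of,
          ← sub_eq_zero, ← map_sub]
        exact mk_eq_zero (Or.inl (Or.inl (Or.inr ⟨_, _, _, rfl⟩)))

theorem pairing_mul_swap (x y z : FreeNonAssoc (Fin m)) :
    pairing m n (x * y) z + pairing m n (y * x) z = 0 := by
  induction x using FreeAbelianGroup.induction_on with
  | zero => simp
  | neg s h =>
    rw [neg_mul, mul_neg, map_neg, map_neg, AddMonoidHom.neg_apply, AddMonoidHom.neg_apply,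
      ← neg_add, h, neg_zero]
  | add x x' h h' =>
    rw [add_mul, mul_add, map_add, map_add, AddMonoidHom.add_apply, AddMonoidHom.add_apply,
      add_add_add_comm, h, h', add_zero]
  | of s =>
    induction y using FreeAbelianGroup.induction_on with
    | zero => simp
    | neg s h =>
      rw [neg_mul, mul_neg, map_neg, map_neg, AddMonoidHom.neg_apply, AddMonoidHom.neg_apply,
        ← neg_add, h, neg_zero]
    | add x x' h h' =>
      rw [add_mul, mul_add, map_add, map_add, AddMonoidHom.add_apply, AddMonoidHom.add_apply,
        add_add_add_comm, h, h', add_zero]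
    | of t =>
      induction z using FreeAbelianGroup.induction_on with
      | zero => simp
      | neg s h => rw [map_neg, map_neg, ← neg_add, h, neg_zero]
      | add x x' h h' => rw [map_add, map_add, add_add_add_comm, h, h', add_zero]
      | of u =>
        rw [FreeAbelianGroup.of_mul_of, FreeAbelianGroup.of_mul_of, pairing_of, pairing_of,
          ← map_add]
        exact mk_eq_zero (Or.inl (Or.inr ⟨_, _, _, rfl⟩))

theorem pairing_jacobi (a b c : FreeMagma (Fin m)) (z : FreeNonAssoc (Fin m)) :
    pairing m n (.of (a * (b * c)) - .of (a * b * c) - .of (b * (a * c))) z = 0 := by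
  induction z using FreeAbelianGroup.induction_on with
  | zero => simp
  | neg s h => rw [map_neg, h, neg_zero]
  | add x x' h h' => rw [map_add, h, h', add_zero]
  | of u =>
    simp only [map_sub, AddMonoidHom.sub_apply, pairing_of]
    rw [← map_sub, ← map_sub]
    exact mk_eq_zero (Or.inr ⟨_, _, _, _, rfl⟩)

theorem pairing_square_add_self (x z : FreeNonAssoc (Fin m)) :
    pairing m n z (x * x) + pairing m n z (x * x) = 0 := by
  rw [pairing_comm z, pairing_mul_swap]

/-- The additive map `x ↦ ⟨i, (x, x)⟩` on the free nonassociative ring. -/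
def doublingFree (m n : ℕ) (i : Fin m) : FreeNonAssoc (Fin m) →+ Tgrp m n :=
  AddMonoidHom.mk' (fun x => pairing m n (.of (.of i)) (x * x)) fun x y => by
    have h := pairing_mul_swap (n := n) x y (.of (.of i))
    rw [pairing_comm, pairing_comm (y * x)] at h
    rw [← add_zero (pairing m n _ (x * x) + _), ← h]
    simp only [add_mul, mul_add, map_add]
    abel

/-- The ideal of elements congruent modulo two to elements of the radical of the pairing. -/
def radicalIdeal (m n : ℕ) : TwoSidedIdeal (FreeNonAssoc (Fin m)) :=
  .mk' {x | ∃ u, ∀ y, pairing m n (x - (u + u)) y = 0} ⟨0, fun y => by simp⟩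
    (by
      rintro x y ⟨u, hu⟩ ⟨v, hv⟩
      refine ⟨u + v, fun z => ?_⟩
      rw [show x + y - (u + v + (u + v)) = x - (u + u) + (y - (v + v)) by abel, map_add,
        AddMonoidHom.add_apply, hu, hv, add_zero])
    (by
      rintro x ⟨u, hu⟩
      refine ⟨-u, fun z => ?_⟩
      rw [show -x - (-u + -u) = -(x - (u + u)) by abel, map_neg, AddMonoidHom.neg_apply, hu,
        neg_zero])
    (by
      rintro x y ⟨u, hu⟩
      refine ⟨x * u, fun z => ?_⟩
      have h := pairing_mul_swap (n := n) x (y - (u + u)) z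
      rwa [pairing_mul_left (y - (u + u)), hu, add_zero, mul_sub, mul_add] at h)
    (by
      rintro x y ⟨u, hu⟩
      refine ⟨u * y, fun z => ?_⟩
      rw [← add_mul, ← sub_mul, pairing_mul_left, hu])

theorem mem_radicalIdeal {x : FreeNonAssoc (Fin m)} :
    x ∈ radicalIdeal m n ↔ ∃ u, ∀ y, pairing m n (x - (u + u)) y = 0 := TwoSidedIdeal.mem_mk' ..

theorem qlRels_subset_radicalIdeal : qlRels (Fin m) ⊆ radicalIdeal m n := by
  intro x hx
  rw [SetLike.mem_coe, mem_radicalIdeal]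
  obtain (⟨a, rfl⟩ | ⟨a, b, rfl⟩) | ⟨a, b, c, rfl⟩ := hx
  · exact ⟨.of a, fun y => by rw [sub_self, map_zero]; rfl⟩
  · refine ⟨0, fun y => ?_⟩
    rw [add_zero, sub_zero, map_add, AddMonoidHom.add_apply, ← FreeAbelianGroup.of_mul_of,
      ← FreeAbelianGroup.of_mul_of, pairing_mul_swap]
  · refine ⟨.of (a * b * c) + .of (b * (a * c)), fun y => ?_⟩
    rw [← pairing_jacobi a b c y]
    congr 2
    abel

theorem doublingFree_eq_zero (i : Fin m) {x : FreeNonAssoc (Fin m)} (hx : x ∈ radicalIdeal m n) :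
    doublingFree m n i x = 0 := by
  obtain ⟨u, hu⟩ := mem_radicalIdeal.1 hx
  have hw : doublingFree m n i (x - (u + u)) = 0 := by
    rw [doublingFree, AddMonoidHom.mk'_apply, pairing_comm, pairing_mul_left, hu]
  have htwo : doublingFree m n i (u + u) = 0 := by
    rw [map_add]
    exact pairing_square_add_self (n := n) u (.of (.of i))
  rwa [map_sub, htwo, sub_zero] at hw

/-- The additive map `J ↦ ⟨i, (J, J)⟩`. -/
def doubling (m n : ℕ) (i : Fin m) : QL (Fin m) →+ Tgrp m n :=
  QL.liftAdd (doublingFree m n i) (radicalIdeal m n) qlRels_subset_radicalIdeal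
    fun _ => doublingFree_eq_zero i

theorem doubling_bracket (i : Fin m) (t : RTree m) :
    doubling m n i t.bracket = TMk m n (.of (.leaf i, .node t t)) := by
  rw [doubling, RTree.bracket, QL.liftAdd_tree, doublingFree, AddMonoidHom.mk'_apply,
    FreeAbelianGroup.of_mul_of, pairing_of, RTree.ofMagma_mul, RTree.ofMagma_toMagma]
  rfl

/-- The sum of the maps `J ↦ ⟨i, (J, J)⟩` over all labels. -/
def doublingSum (m n : ℕ) : (Fin m → QL (Fin m)) →+ Tgrp m n :=
  ∑ i, (doubling m n i).comp (Pi.evalAddMonoidHom _ i)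

theorem doublingSum_apply (z : Fin m → QL (Fin m)) :
    doublingSum m n z = ∑ i, doubling m n i (z i) := by
  rw [doublingSum, AddMonoidHom.finsetSum_apply]
  rfl

theorem doublingSum_single (i : Fin m) (x : QL (Fin m)) :
    doublingSum m n (Pi.single i x) = doubling m n i x := by
  rw [doublingSum_apply, Finset.sum_eq_single i, Pi.single_eq_same]
  · intro j _ hj
    rw [Pi.single_eq_of_ne hj, map_zero]
  · exact fun h => absurd (Finset.mem_univ i) h

end Tgrp

namespace Tgrp

variable {m n : ℕ}

theorem sum_rerootList (a b : RTree m) :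
    ((rerootList a b).map fun v => TMk m n (.of (.leaf v.1, .node v.2 v.2))).sum =
      doublingSum m n (QL.reroot a.bracket b.bracket) := by
  induction a generalizing b with
  | leaf i =>
    rw [QL.reroot_leaf, doublingSum_single, doubling_bracket, rerootList, List.map_singleton,
      List.sum_singleton]
  | node a c ha hc =>
    rw [rerootList, List.map_append, List.sum_append, ha, hc, RTree.bracket_node,
      RTree.bracket_node, RTree.bracket_node, QL.reroot_mul, map_add]

theorem sum_pairReroots (p : RTree m × RTree m) :
    ((pairReroots p).map fun v => TMk m n (.of (.leaf v.1, .node v.2 v.2))).sum =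
      doublingSum m n (QL.rootings p.1.bracket p.2.bracket) := by
  rw [pairReroots, List.map_append, List.sum_append, sum_rerootList, sum_rerootList, ← map_add,
    QL.rootings_apply]

theorem deg_of_mem_rerootList {a b : RTree m} {v : Fin m × RTree m} (hv : v ∈ rerootList a b) :
    v.2.deg + 1 = a.deg + b.deg := by
  induction a generalizing b with
  | leaf i =>
    rw [List.mem_singleton.1 hv]
    exact Nat.add_comm _ _
  | node a c ha hc =>
    simp only [RTree.deg] at ha hc ⊢
    rcases List.mem_append.1 hv with h | h
    · have := ha h
      simp only [RTree.deg] at this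
      omega
    · have := hc h
      simp only [RTree.deg] at this
      omega

theorem mk_of_deg_ne {p : RTree m × RTree m} (h : p.1.deg + p.2.deg ≠ n + 2) :
    TMk m n (.of p) = 0 :=
  mk_eq_zero (Or.inl (Or.inl (Or.inl (Or.inl ⟨p, h, rfl⟩))))

theorem sum_rerootList_eq_zero {a b : RTree m} (h : 2 * (a.deg + b.deg) ≠ n + 3) :
    ((rerootList a b).map fun v => TMk m n (.of (.leaf v.1, .node v.2 v.2))).sum = 0 := by
  refine List.sum_eq_zero fun x hx => ?_
  obtain ⟨v, hv, rfl⟩ := List.mem_map.1 hx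
  have := deg_of_mem_rerootList hv
  refine mk_of_deg_ne ?_
  simp only [RTree.deg]
  omega

theorem doublingSum_rootings_eq_zero {a b : RTree m} (h : 2 * (a.deg + b.deg) ≠ n + 3) :
    doublingSum m n (QL.rootings a.bracket b.bracket) = 0 := by
  rw [← sum_pairReroots (a, b), pairReroots, List.map_append, List.sum_append,
    sum_rerootList_eq_zero h, sum_rerootList_eq_zero (by rwa [add_comm b.deg]), add_zero]

/-- Auxiliary definition of `rootings` on the free abelian group on pairs. -/
def rootingsFree (m n : ℕ) : FreeAbelianGroup (RTree m × RTree m) →+ Fin m → QL (Fin m) :=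
  FreeAbelianGroup.lift fun p =>
    if p.1.deg + p.2.deg = n + 2 then QL.rootings p.1.bracket p.2.bracket else 0

theorem rootingsFree_of (p : RTree m × RTree m) :
    rootingsFree m n (.of p) =
      if p.1.deg + p.2.deg = n + 2 then QL.rootings p.1.bracket p.2.bracket else 0 :=
  FreeAbelianGroup.lift_apply_of _ _

theorem closure_treeRels_le : AddSubgroup.closure (treeRels m n) ≤ (rootingsFree m n).ker := by
  rw [AddSubgroup.closure_le]
  rintro x ((((⟨p, hp, rfl⟩ | ⟨I, J, rfl⟩) | ⟨A, B, C, rfl⟩) | ⟨A, B, C, rfl⟩) |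
    ⟨A, B, C, D, rfl⟩) <;>
    simp only [SetLike.mem_coe, AddMonoidHom.mem_ker, map_add, map_sub, rootingsFree_of, RTree.deg,
      RTree.bracket_node]
  · rw [if_neg hp]
  · rw [add_comm J.deg, QL.rootings_comm, sub_self]
  · rw [add_assoc A.deg, QL.rootings_mul_left, sub_self]
  · rw [add_comm B.deg, IsQuasiLieTwo.mul_comm B.bracket]
    split_ifs
    · exact QL.pi_add_self _
    · exact add_zero 0
  · rw [← add_assoc A.deg, add_left_comm B.deg, ← add_assoc A.deg, IsQuasiLieTwo.jacobi A.bracket]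
    split_ifs
    · rw [map_add, AddMonoidHom.add_apply]
      abel
    · simp

/-- The sum of the rootings of an unrooted tree. -/
def rootings (m n : ℕ) : Tgrp m n →+ Fin m → QL (Fin m) :=
  QuotientAddGroup.lift _ (rootingsFree m n) closure_treeRels_le

theorem rootings_mk (p : RTree m × RTree m) :
    rootings m n (TMk m n (.of p)) =
      if p.1.deg + p.2.deg = n + 2 then QL.rootings p.1.bracket p.2.bracket else 0 :=
  rootingsFree_of p

theorem rootings_doubling {k : ℕ} (hk : 1 ≤ k) (i : Fin m) (x : QL (Fin m)) :
    rootings m (2 * k - 1) (doubling m (2 * k - 1) i x) =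
      Pi.single i (QL.degreePart k x * QL.degreePart k x) := by
  induction x using QL.rtree_induction with
  | zero => simp
  | add x y hx hy =>
    rw [map_add, map_add, hx, hy, map_add, IsQuasiLieTwo.add_mul_add_self, Pi.single_add]
  | bracket t =>
    rw [doubling_bracket, rootings_mk, QL.degreePart_bracket]
    by_cases h : t.deg = k
    · rw [if_pos h, if_pos (by simp only [RTree.deg]; omega), RTree.bracket_node,
        QL.rootings_leaf_square]
    · rw [if_neg h, if_neg (by simp only [RTree.deg]; omega), mul_zero, Pi.single_zero]

theorem rootings_doublingSum {k : ℕ} (hk : 1 ≤ k) (z : Fin m → QL (Fin m)) (i : Fin m) :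
    rootings m (2 * k - 1) (doublingSum m (2 * k - 1) z) i =
      QL.degreePart k (z i) * QL.degreePart k (z i) := by
  rw [doublingSum_apply, map_sum]
  simp only [rootings_doubling hk]
  exact congrFun (Finset.univ_sum_single fun i => QL.degreePart k (z i) * QL.degreePart k (z i)) i

end Tgrp

/-- The defining property of the framing map `Δ` from `𝒯_{k-1}` to `𝒯_{2k-1}`. -/
def IsFramingMap {m k : ℕ} (Δ : Tgrp m (k - 1) →+ Tgrp m (2 * k - 1)) : Prop :=
  ∀ p : RTree m × RTree m, p.1.deg + p.2.deg = (k - 1) + 2 →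
    Δ (TMk m (k - 1) (.of p)) =
      ((pairReroots p).map fun v => TMk m (2 * k - 1) (.of (.leaf v.1, .node v.2 v.2))).sum

namespace IsFramingMap

variable {m k : ℕ} {Δ : Tgrp m (k - 1) →+ Tgrp m (2 * k - 1)}

theorem doublingSum_rootings_mem (hΔ : IsFramingMap Δ) (hk : 1 ≤ k) (x y : QL (Fin m)) :
    Tgrp.doublingSum m (2 * k - 1) (QL.rootings x y) ∈ Δ.range := by
  induction x using QL.rtree_induction with
  | zero => rw [map_zero, AddMonoidHom.zero_apply, map_zero]; exact zero_mem _
  | add x x' h h' => rw [map_add, AddMonoidHom.add_apply, map_add]; exact add_mem h h'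
  | bracket s =>
    induction y using QL.rtree_induction with
    | zero => rw [map_zero, map_zero]; exact zero_mem _
    | add x x' h h' => rw [map_add, map_add]; exact add_mem h h'
    | bracket t =>
      by_cases h : s.deg + t.deg = k - 1 + 2
      · exact ⟨_, (hΔ (s, t) h).trans (Tgrp.sum_pairReroots (s, t))⟩
      · rw [Tgrp.doublingSum_rootings_eq_zero (by omega)]
        exact zero_mem _

theorem exists_of_mem_range (hΔ : IsFramingMap Δ) {g : Tgrp m (2 * k - 1)} (hg : g ∈ Δ.range) :
    ∃ z, QL.bracketSum z = 0 ∧ Tgrp.doublingSum m (2 * k - 1) z = g := by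
  obtain ⟨g, rfl⟩ := hg
  obtain ⟨x, rfl⟩ := QuotientAddGroup.mk'_surjective _ g
  induction x using FreeAbelianGroup.induction_on with
  | zero => exact ⟨0, map_zero _, by simp⟩
  | of p =>
    by_cases h : p.1.deg + p.2.deg = k - 1 + 2
    · exact ⟨_, QL.bracketSum_rootings _ _, ((hΔ p h).trans (Tgrp.sum_pairReroots p)).symm⟩
    · exact ⟨0, map_zero _, by rw [Tgrp.mk_of_deg_ne h, map_zero, map_zero]⟩
  | neg p h =>
    obtain ⟨z, hz, h⟩ := h
    exact ⟨-z, by rw [map_neg, hz, neg_zero], by rw [map_neg, map_neg, map_neg, h]⟩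
  | add x y hx hy =>
    obtain ⟨z, hz, hx⟩ := hx
    obtain ⟨z', hz', hy⟩ := hy
    exact ⟨z + z', by rw [map_add, hz, hz', add_zero], by rw [map_add, map_add, map_add, hx, hy]⟩

/-- The class of a sum of doublings modulo the framing relations. -/
def doublingClass (Δ : Tgrp m (k - 1) →+ Tgrp m (2 * k - 1)) :
    (Fin m → QL (Fin m)) →+ Tgrp m (2 * k - 1) ⧸ Δ.range :=
  (QuotientAddGroup.mk' Δ.range).comp (Tgrp.doublingSum m (2 * k - 1))

theorem doublingClass_add_self (z : Fin m → QL (Fin m)) :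
    doublingClass Δ z + doublingClass Δ z = 0 := by
  rw [← map_add, QL.pi_add_self, map_zero]

theorem doublingClass_reroot_comm (hΔ : IsFramingMap Δ) (hk : 1 ≤ k) (x y : QL (Fin m)) :
    doublingClass Δ (QL.reroot x y) + doublingClass Δ (QL.reroot y x) = 0 := by
  rw [← map_add, ← QL.rootings_apply]
  exact (QuotientAddGroup.eq_zero_iff _).2 (hΔ.doublingSum_rootings_mem hk x y)

/-- Auxiliary definition of `bracketClass` on the free nonassociative ring. -/
def bracketClassFree (Δ : Tgrp m (k - 1) →+ Tgrp m (2 * k - 1)) :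
    FreeNonAssoc (Fin m) →+ Tgrp m (2 * k - 1) ⧸ Δ.range :=
  FreeAbelianGroup.lift fun
    | .of _ => 0
    | .mul s t => doublingClass Δ (QL.reroot (QL.tree s) (QL.tree t))

theorem bracketClassFree_mul (x y : FreeNonAssoc (Fin m)) :
    bracketClassFree Δ (x * y) = doublingClass Δ (QL.reroot (QL.mk x) (QL.mk y)) := by
  induction x using FreeAbelianGroup.induction_on with
  | zero => simp
  | neg s h => rw [neg_mul, map_neg, h, map_neg, map_neg, AddMonoidHom.neg_apply, map_neg]
  | add x x' h h' => rw [add_mul, map_add, h, h', map_add, map_add, AddMonoidHom.add_apply, map_add]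
  | of s =>
    induction y using FreeAbelianGroup.induction_on with
    | zero => simp
    | neg s h => rw [mul_neg, map_neg, h, map_neg, map_neg, map_neg]
    | add x x' h h' => rw [mul_add, map_add, h, h', map_add, map_add, map_add]
    | of t =>
      rw [FreeAbelianGroup.of_mul_of]
      exact FreeAbelianGroup.lift_apply_of _ _

theorem bracketClassFree_qlRels (hΔ : IsFramingMap Δ) (hk : 1 ≤ k) {x : FreeNonAssoc (Fin m)}
    (hx : x ∈ qlRels (Fin m)) : bracketClassFree Δ x = 0 := by
  obtain (⟨a, rfl⟩ | ⟨a, b, rfl⟩) | ⟨a, b, c, rfl⟩ := hx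
  · cases a with
    | of i => simp [bracketClassFree]
    | mul s t =>
      rw [show FreeMagma.mul s t = s * t from rfl, map_add, ← FreeAbelianGroup.of_mul_of,
        bracketClassFree_mul, doublingClass_add_self]
  · rw [map_add, ← FreeAbelianGroup.of_mul_of, ← FreeAbelianGroup.of_mul_of, bracketClassFree_mul,
      bracketClassFree_mul, hΔ.doublingClass_reroot_comm hk]
  · simp only [map_add, ← FreeAbelianGroup.of_mul_of, bracketClassFree_mul, map_mul,
      QL.reroot_mul]
    rw [IsQuasiLieTwo.mul_comm (QL.mk (.of c)), add_assoc, add_assoc,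
      doublingClass_add_self, add_zero, doublingClass_add_self]

/-- The homomorphism sending a bracket `[X, Y]` to the sum of the doublings of the rootings of
`⟨X, Y⟩` at the letters of `X`. -/
def bracketClass (hΔ : IsFramingMap Δ) (hk : 1 ≤ k) :
    QL (Fin m) →+ Tgrp m (2 * k - 1) ⧸ Δ.range :=
  QL.liftAddOfMul (bracketClassFree Δ) (fun _ => hΔ.bracketClassFree_qlRels hk)
    (fun x y h _ => by
      rw [bracketClassFree_mul, h, map_zero, AddMonoidHom.zero_apply, map_zero])
    (fun x y h _ => by rw [bracketClassFree_mul, h, map_zero, map_zero])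

theorem bracketClass_leaf (hΔ : IsFramingMap Δ) (hk : 1 ≤ k) (i : Fin m) :
    hΔ.bracketClass hk (RTree.leaf i).bracket = 0 := by
  rw [bracketClass, RTree.bracket, QL.liftAddOfMul_tree]
  exact FreeAbelianGroup.lift_apply_of _ _

theorem bracketClass_node (hΔ : IsFramingMap Δ) (hk : 1 ≤ k) (a b : RTree m) :
    hΔ.bracketClass hk (RTree.node a b).bracket =
      doublingClass Δ (QL.reroot a.bracket b.bracket) := by
  rw [bracketClass, RTree.bracket, QL.liftAddOfMul_tree]
  exact FreeAbelianGroup.lift_apply_of _ _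

theorem exists_doublingClass (hΔ : IsFramingMap Δ) (hk : 1 ≤ k) (x : QL (Fin m)) :
    ∃ z, QL.toLp m (k + 1) (QL.bracketSum z) = QL.toLp m (k + 1) x ∧
      doublingClass Δ z = hΔ.bracketClass hk x := by
  induction x using QL.rtree_induction with
  | zero => exact ⟨0, by simp, by simp⟩
  | add x y hx hy =>
    obtain ⟨z, hz, hx⟩ := hx
    obtain ⟨z', hz', hy⟩ := hy
    exact ⟨z + z', by rw [map_add, map_add, hz, hz', map_add], by rw [map_add, hx, hy, map_add]⟩
  | bracket t =>
    cases t with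
    | leaf i =>
      refine ⟨0, ?_, by rw [map_zero, bracketClass_leaf]⟩
      rw [QL.toLp_bracket_of_ne (by simp only [RTree.deg]; omega), map_zero, map_zero]
    | node a b =>
      exact ⟨QL.reroot a.bracket b.bracket, by rw [QL.bracketSum_reroot, RTree.bracket_node],
        (hΔ.bracketClass_node hk a b).symm⟩

theorem eq_zero_of_bracketClass_eq_zero (hΔ : IsFramingMap Δ) (hk : 1 ≤ k)
    {x : QL (Fin m)} (hx : hΔ.bracketClass hk x = 0) : QL.toLp m (k + 1) x = 0 := by
  obtain ⟨z, hz, hzx⟩ := hΔ.exists_doublingClass hk x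
  rw [hx] at hzx
  obtain ⟨z₀, hz₀, hzz₀⟩ := hΔ.exists_of_mem_range ((QuotientAddGroup.eq_zero_iff _).1 hzx)
  have h : Tgrp.doublingSum m (2 * k - 1) (z - z₀) = 0 := by rw [map_sub, hzz₀, sub_self]
  rw [← hz, ← sub_zero (QL.bracketSum z), ← hz₀, ← map_sub]
  refine QL.toLp_bracketSum_eq_zero fun i => ?_
  rw [← Tgrp.rootings_doublingSum hk, h, map_zero]
  rfl

/-- The natural map from `𝒯_{2k-1}` to `𝒯^∞_{2k-1}`. -/
def toTinfodd (m k : ℕ) : Tgrp m (2 * k - 1) →+ Tinfodd m k :=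
  QuotientAddGroup.map _ _ (.id _) (AddSubgroup.closure_mono Set.subset_union_left)

theorem toTinfodd_doublingSum (hk : 1 ≤ k) (z : Fin m → QL (Fin m)) :
    toTinfodd m k (Tgrp.doublingSum m (2 * k - 1) z) = 0 := by
  rw [Tgrp.doublingSum_apply, map_sum]
  refine Finset.sum_eq_zero fun i _ => ?_
  generalize z i = x
  induction x using QL.rtree_induction with
  | zero => rw [map_zero, map_zero]
  | add x y hx hy => rw [map_add, map_add, hx, hy, add_zero]
  | bracket t =>
    rw [Tgrp.doubling_bracket]
    by_cases h : t.deg = k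
    · have hslide : TMk m (2 * k - 1) (.of (.node (.leaf i) t, t)) =
          TMk m (2 * k - 1) (.of (.leaf i, .node t t)) := by
        rw [← sub_eq_zero, ← map_sub]
        exact Tgrp.mk_eq_zero (Or.inl (Or.inl (Or.inr ⟨_, _, _, rfl⟩)))
      rw [← hslide]
      exact (QuotientAddGroup.eq_zero_iff _).2
        (AddSubgroup.subset_closure (Or.inr ⟨i, t, h, rfl⟩))
    · rw [Tgrp.mk_of_deg_ne (by simp only [RTree.deg]; omega), map_zero]

theorem range_le_ker (hΔ : IsFramingMap Δ) (hk : 1 ≤ k) : Δ.range ≤ (toTinfodd m k).ker := by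
  intro g hg
  obtain ⟨z, -, rfl⟩ := hΔ.exists_of_mem_range hg
  exact toTinfodd_doublingSum hk z

theorem mem_range_of_mem_closure (hΔ : IsFramingMap Δ) (hk : 1 ≤ k)
    {x : FreeAbelianGroup (RTree m × RTree m)}
    (hx : x ∈ AddSubgroup.closure (treeRels m (2 * k - 1) ∪ btRels m k)) :
    QuotientAddGroup.mk' Δ.range (TMk m (2 * k - 1) x) ∈
      ((hΔ.bracketClass hk).comp (QL.ofLp m (k + 1))).range := by
  induction hx using AddSubgroup.closure_induction with
  | zero => rw [map_zero, map_zero]; exact zero_mem _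
  | add x y _ _ hx hy => rw [map_add, map_add]; exact add_mem hx hy
  | neg x _ hx => rw [map_neg, map_neg]; exact neg_mem hx
  | mem x hx =>
    obtain hx | ⟨i, J, hJ, rfl⟩ := hx
    · rw [Tgrp.mk_eq_zero hx, map_zero]
      exact zero_mem _
    · refine ⟨1 ⊗ₜ LpMk m (k + 1) (.of (.node (.leaf i) J)), ?_⟩
      have hslide : TMk m (2 * k - 1) (.of (.node (.leaf i) J, J)) =
          TMk m (2 * k - 1) (.of (.leaf i, .node J J)) := by
        rw [← sub_eq_zero, ← map_sub]
        exact Tgrp.mk_eq_zero (Or.inl (Or.inl (Or.inr ⟨_, _, _, rfl⟩)))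
      rw [AddMonoidHom.comp_apply, QL.ofLp_tmul, one_smul,
        if_pos (by simp only [RTree.deg]; omega), bracketClass_node, QL.reroot_leaf, hslide,
        doublingClass, AddMonoidHom.comp_apply, Tgrp.doublingSum_single, Tgrp.doubling_bracket]

end IsFramingMap


/-- For all `m,k ≥ 1`, the natural surjection `𝒯̃_{2k-1} → 𝒯^∞_{2k-1}`
induced by the identity on generators is well defined, and its kernel is isomorphic
to `ℤ₂ ⊗ L'_{k+1}`: there is a short exact sequence
`0 → ℤ₂ ⊗ L'_{k+1} → 𝒯̃_{2k-1} → 𝒯^∞_{2k-1} → 0`.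
Here `𝒯̃_{2k-1} = 𝒯_{2k-1}/im(Δ_{2k-1})` with `Δ_{2k-1}` the framing-relation map. -/
theorem statement6 (m k : ℕ) (hm : 1 ≤ m) (hk : 1 ≤ k)
    (Δ : Tgrp m (k - 1) →+ Tgrp m (2 * k - 1))
    (hΔ : ∀ p : RTree m × RTree m, p.1.deg + p.2.deg = (k - 1) + 2 →
      Δ (TMk m (k - 1) (FreeAbelianGroup.of p)) =
        ((pairReroots p).map fun v =>
          TMk m (2 * k - 1)
            (FreeAbelianGroup.of (RTree.leaf v.1, RTree.node v.2 v.2))).sum) :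
    ∃ π : (Tgrp m (2 * k - 1) ⧸ Δ.range) →+ Tinfodd m k,
      (∀ x : FreeAbelianGroup (RTree m × RTree m),
        π (QuotientAddGroup.mk' Δ.range (TMk m (2 * k - 1) x)) = TinfoddMk m k x) ∧
      Function.Surjective π ∧
      ∃ ι : ((ZMod 2) ⊗[ℤ] (Lp m (k + 1))) →+ (Tgrp m (2 * k - 1) ⧸ Δ.range),
        Function.Injective ι ∧ ι.range = π.ker := by
  have hΔ : IsFramingMap Δ := hΔ
  have hker := hΔ.range_le_ker hk
  refine ⟨QuotientAddGroup.lift Δ.range (IsFramingMap.toTinfodd m k) hker, fun x => rfl, ?_,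
    (hΔ.bracketClass hk).comp (QL.ofLp m (k + 1)), ?_, le_antisymm ?_ ?_⟩
  · intro y
    obtain ⟨x, rfl⟩ := QuotientAddGroup.mk'_surjective _ y
    exact ⟨QuotientAddGroup.mk' Δ.range (TMk m (2 * k - 1) x), rfl⟩
  · refine (injective_iff_map_eq_zero _).2 fun y hy => ?_
    rw [← QL.toLp_ofLp (k + 1) y]
    exact hΔ.eq_zero_of_bracketClass_eq_zero hk hy
  · rintro _ ⟨y, rfl⟩
    obtain ⟨z, -, hz⟩ := hΔ.exists_doublingClass hk (QL.ofLp m (k + 1) y)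
    rw [AddMonoidHom.mem_ker, AddMonoidHom.comp_apply, ← hz]
    exact IsFramingMap.toTinfodd_doublingSum hk z
  · intro y hy
    obtain ⟨y, rfl⟩ := QuotientAddGroup.mk'_surjective _ y
    obtain ⟨x, rfl⟩ := QuotientAddGroup.mk'_surjective _ y
    exact hΔ.mem_range_of_mem_closure hk ((QuotientAddGroup.eq_zero_iff x).1 hy)
end

section
/- For all integers m ≥ 1 and k ≥ 1, the sequence ℤ₂ ⊗ D'_{k−1} → ℤ₂ ⊗ (L_1 ⊗ L_k) → ℤ₂ ⊗ L'_{k+1} → 0 is exact, where the first map is induced by the inclusion D'_{k−1} ⊆ L'_1 ⊗ L'_k followed by the identification L'_1 = L_1 and the projection L'_k → L_k, and the second map is induced by X ⊗ Y ↦ [X, Ŷ] ∈ L'_{k+1}, where Ŷ is any lift of Y to L'_k (this is well defined modulo 2 since [X,[Y,Y]] = 0 in L'). -/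
open scoped TensorProduct

/-- Composition of one-hole contexts: plug `d` into the hole of `c`. -/
def Ctx.comp_s7 {m : ℕ} : Ctx m → Ctx m → Ctx m
  | .hole, d => d
  | .nodeL c r, d => .nodeL (c.comp_s7 d) r
  | .nodeR l c, d => .nodeR l (c.comp_s7 d)

theorem Ctx.fill_comp_s7 {m : ℕ} (c d : Ctx m) (t : RTree m) :
    (c.comp_s7 d).fill t = c.fill (d.fill t) := by
  induction c with
  | hole => rfl
  | nodeL c r ih => simp [Ctx.comp_s7, Ctx.fill, ih]
  | nodeR l c ih => simp [Ctx.comp_s7, Ctx.fill, ih]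

theorem LpMk_antisymm {m : ℕ} (n : ℕ) (c : Ctx m) (A B : RTree m) :
    LpMk m n (.of (c.fill (.node A B))) = -LpMk m n (.of (c.fill (.node B A))) := by
  rw [eq_neg_iff_add_eq_zero, ← map_add]
  exact (QuotientAddGroup.eq_zero_iff _).2
    (AddSubgroup.subset_closure (Or.inl (Or.inr ⟨c, A, B, rfl⟩)))

theorem LpMk_jacobi {m : ℕ} (n : ℕ) (c : Ctx m) (A B C : RTree m) :
    LpMk m n (.of (c.fill (.node A (.node B C)))) =
      LpMk m n (.of (c.fill (.node (.node A B) C))) +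
        LpMk m n (.of (c.fill (.node B (.node A C)))) := by
  rw [← sub_eq_zero, ← sub_sub, ← map_sub, ← map_sub]
  exact (QuotientAddGroup.eq_zero_iff _).2
    (AddSubgroup.subset_closure (Or.inr ⟨c, A, B, C, rfl⟩))

/-- In the free quasi-Lie ring, a bracket with a proper subbracket `[J,J]` vanishes. -/
theorem LpMk_node_square {m : ℕ} (n : ℕ) (c d : Ctx m) (A J : RTree m) :
    LpMk m n (.of (d.fill (.node A (c.fill (.node J J))))) = 0 := by
  induction c generalizing d A with
  | hole =>
    rw [Ctx.fill, LpMk_jacobi, LpMk_antisymm n d (.node A J) J, neg_add_cancel]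
  | nodeL c r ih =>
    have h := ih (d.comp_s7 (.nodeR A .hole)) r
    simp only [Ctx.fill_comp_s7, Ctx.fill] at h ⊢
    have h2 := LpMk_antisymm n (d.comp_s7 (.nodeR A .hole)) (c.fill (.node J J)) r
    simp only [Ctx.fill_comp_s7, Ctx.fill] at h2
    rw [h2, h, neg_zero]
  | nodeR l c ih =>
    have h := ih (d.comp_s7 (.nodeR A .hole)) l
    simpa only [Ctx.fill_comp_s7, Ctx.fill] using h

theorem brLeafFree_closure_lie_quasi {m n : ℕ} (i : Fin m) :
    AddSubgroup.closure (lieRels m n) ≤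
      (AddSubgroup.closure (quasiLieRels m (n + 1))).comap (brLeafFree m i) := by
  refine (AddSubgroup.closure_le _).2 ?_
  rintro x (hx | ⟨c, J, rfl⟩)
  · exact AddSubgroup.mem_comap.2 (brLeafFree_mem_quasi i hx)
  · refine AddSubgroup.mem_comap.2 ((QuotientAddGroup.eq_zero_iff _).1 ?_)
    simpa [brLeafFree, Ctx.fill] using LpMk_node_square (n + 1) c .hole (.leaf i) J

/-- Bracketing `[X_i, ·]` factors through a map `L_n → L'_{n+1}`. -/
def brLeafLift (m n : ℕ) (i : Fin m) : LL m n →+ Lp m (n + 1) :=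
  QuotientAddGroup.map _ _ (brLeafFree m i) (brLeafFree_closure_lie_quasi i)

/-- The map `L_1 ⊗ L_n → L'_{n+1}`, `X ⊗ Y ↦ [X, Ŷ]` for any lift `Ŷ` of `Y` to `L'_n`. -/
noncomputable def bracketLift (m n : ℕ) :
    (FreeAbelianGroup (Fin m)) ⊗[ℤ] (LL m n) →ₗ[ℤ] Lp m (n + 1) :=
  TensorProduct.lift
    ((FreeAbelianGroup.lift fun i => (brLeafLift m n i).toIntLinearMap).toIntLinearMap)

theorem bracketLift_tmul_mk {m n : ℕ} (i : Fin m) (t : FreeAbelianGroup (RTree m)) :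
    bracketLift m n (FreeAbelianGroup.of i ⊗ₜ LLMk m n t) =
      LpMk m (n + 1) (brLeafFree m i t) := by
  refine (TensorProduct.lift.tmul _ _).trans ?_
  exact LinearMap.congr_fun (FreeAbelianGroup.lift_apply_of
    (fun i => (brLeafLift m n i).toIntLinearMap) i) (LLMk m n t)

theorem bracketLp_tmul_mk {m n : ℕ} (i : Fin m) (t : FreeAbelianGroup (RTree m)) :
    bracketLp m n (FreeAbelianGroup.of i ⊗ₜ LpMk m n t) =
      LpMk m (n + 1) (brLeafFree m i t) := by
  refine (TensorProduct.lift.tmul _ _).trans ?_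
  exact LinearMap.congr_fun (FreeAbelianGroup.lift_apply_of
    (fun i => (brLeaf m n i).toIntLinearMap) i) (LpMk m n t)

theorem brLeafFree_of {m : ℕ} (i : Fin m) (T : RTree m) :
    brLeafFree m i (.of T) = .of (.node (.leaf i) T) :=
  FreeAbelianGroup.lift_apply_of _ _

theorem bracketLift_comp_projT (m n : ℕ) :
    bracketLift m n ∘ₗ projT m n = bracketLp m n := by
  refine TensorProduct.ext (LinearMap.toAddMonoidHom_injective ?_)
  refine FreeAbelianGroup.lift_ext _ _ fun i => LinearMap.ext fun y => ?_
  obtain ⟨y, rfl⟩ := QuotientAddGroup.mk'_surjective _ y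
  exact (bracketLift_tmul_mk i y).trans (bracketLp_tmul_mk i y).symm

theorem projT_surjective (m n : ℕ) : Function.Surjective (projT m n) := by
  refine LinearMap.lTensor_surjective _ fun y => ?_
  obtain ⟨y, rfl⟩ := QuotientAddGroup.mk'_surjective _ y
  exact ⟨LpMk m n y, rfl⟩

theorem LpMk_node_mem_range {m : ℕ} (n : ℕ) (A B : RTree m) :
    LpMk m (n + 1) (.of (.node A B)) ∈ LinearMap.range (bracketLp m n) := by
  induction A generalizing B with
  | leaf i => exact ⟨_, (bracketLp_tmul_mk i _).trans (congrArg _ (brLeafFree_of i B))⟩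
  | node A₁ A₂ h₁ h₂ =>
    have h := LpMk_jacobi (n + 1) .hole A₁ A₂ B
    simp only [Ctx.fill] at h
    rw [← sub_eq_iff_eq_add] at h
    rw [← h]
    exact sub_mem (h₁ _) (h₂ _)

theorem bracketLp_surjective {m n : ℕ} (hn : 1 ≤ n) : Function.Surjective (bracketLp m n) := by
  intro y
  obtain ⟨y, rfl⟩ := QuotientAddGroup.mk'_surjective _ y
  change LpMk m (n + 1) y ∈ LinearMap.range (bracketLp m n)
  have hof (T : RTree m) : LpMk m (n + 1) (.of T) ∈ LinearMap.range (bracketLp m n) := by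
    cases T with
    | leaf i =>
      have h : LpMk m (n + 1) (.of (.leaf i)) = 0 :=
        (QuotientAddGroup.eq_zero_iff _).2 (AddSubgroup.subset_closure
          (Or.inl (Or.inl ⟨.leaf i, by simp only [RTree.deg]; omega, rfl⟩)))
      rw [h]
      exact zero_mem _
    | node A B => exact LpMk_node_mem_range n A B
  induction y using FreeAbelianGroup.induction_on with
  | zero => rw [map_zero]; exact zero_mem _
  | of T => exact hof T
  | neg T h => rw [map_neg]; exact neg_mem h
  | add y z hy hz => rw [map_add]; exact add_mem hy hz

theorem bracketLift_surjective {m n : ℕ} (hn : 1 ≤ n) :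
    Function.Surjective (bracketLift m n) := by
  refine Function.Surjective.of_comp (g := projT m n) ?_
  rw [← LinearMap.coe_comp, bracketLift_comp_projT]
  exact bracketLp_surjective hn

theorem exact_projT_bracketLift (m n : ℕ) :
    Function.Exact (projT m n ∘ₗ (LinearMap.ker (bracketLp m n)).subtype)
      (bracketLift m n) := by
  intro x
  constructor
  · intro hx
    obtain ⟨y, rfl⟩ := projT_surjective m n x
    rw [← LinearMap.comp_apply, bracketLift_comp_projT] at hx
    exact ⟨⟨y, hx⟩, rfl⟩
  · rintro ⟨y, rfl⟩
    rw [LinearMap.comp_apply, ← LinearMap.comp_apply, bracketLift_comp_projT]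
    exact y.2

/-- For all `m,k ≥ 1`, the sequence
`ℤ₂ ⊗ D'_{k-1} → ℤ₂ ⊗ (L_1 ⊗ L_k) → ℤ₂ ⊗ L'_{k+1} → 0` is exact, where the
first map is induced by the inclusion `D'_{k-1} ⊆ L'_1 ⊗ L'_k` followed by the
identification `L'_1 = L_1` and the projection `L'_k → L_k`, and the second map
`β` is induced by `X ⊗ Y ↦ [X, Ŷ]` for any lift `Ŷ` of `Y` to `L'_k`.
Here `D'_{k-1} = Ker(bracketLp m k)`. -/
theorem statement7 (m k : ℕ) (hm : 1 ≤ m) (hk : 1 ≤ k) :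
    ∃ β : ((ZMod 2) ⊗[ℤ] ((FreeAbelianGroup (Fin m)) ⊗[ℤ] (LL m k))) →+
        ((ZMod 2) ⊗[ℤ] (Lp m (k + 1))),
      (∀ (i : Fin m) (T : RTree m), T.deg = k →
        β ((1 : ZMod 2) ⊗ₜ[ℤ]
            ((FreeAbelianGroup.of i) ⊗ₜ[ℤ] (LLMk m k (FreeAbelianGroup.of T))))
          = (1 : ZMod 2) ⊗ₜ[ℤ]
              (LpMk m (k + 1)
                (FreeAbelianGroup.of (RTree.node (RTree.leaf i) T)))) ∧
      Function.Surjective β ∧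
      (∀ x, β x = 0 ↔
        x ∈ Set.range (LinearMap.lTensor (ZMod 2)
          ((projT m k) ∘ₗ (LinearMap.ker (bracketLp m k)).subtype))) := by
  exact ⟨((bracketLift m k).lTensor (ZMod 2)).toAddMonoidHom,
    fun i T _ => congrArg ((1 : ZMod 2) ⊗ₜ[ℤ] ·) ((bracketLift_tmul_mk i _).trans (congrArg _ (brLeafFree_of i T))),
    LinearMap.lTensor_surjective _ (bracketLift_surjective hk),
    lTensor_exact (ZMod 2) (exact_projT_bracketLift m k) (bracketLift_surjective hk)⟩
end
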